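/- Let F be a finite field of characteristic p = 2 or 3 such that [F : F_p] is a power of 2, and let d be a positive integer with gcd(d, |F|−1) = 1. Then the Weil sum W_{F,d} does not take exactly three values on F*. -/

import Mathlib

open Complex

/-- The canonical additive character of a finite field `F` of characteristic `p`:
`ψ(x) = exp(2πi · Tr_{F/F_p}(x) / p)`. -/
noncomputable def psi (p : ℕ) [Fact p.Prime] (F : Type*) [Field F] [Fintype F]
    [Algebra (ZMod p) F] (x : F) : ℂ :=
  Complex.exp (2 * Real.pi * Complex.I * ((Algebra.trace (ZMod p) F x).val : ℂ) / (p : ℂ))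

/-- The Weil sum `W_{F,d}(u) = Σ_{x ∈ F} ψ(x^d + u x)`. -/
noncomputable def weilSum (p : ℕ) [Fact p.Prime] (F : Type*) [Field F] [Fintype F]
    [Algebra (ZMod p) F] (d : ℕ) (u : F) : ℂ :=
  ∑ x : F, psi p F (x ^ d + u * x)


set_option linter.style.haveILetI false
set_option linter.unusedVariables false
set_option linter.unusedSectionVars false

set_option linter.unusedSectionVars false
namespace Hel

section charsums
open scoped Classical

variable {F : Type*} [Field F] [Fintype F]

/-- The Weil sum for a general additive character. -/
noncomputable def W (ψ : AddChar F ℂ) (d : ℕ) (u : F) : ℂ := ∑ x : F, ψ (x ^ d + u * x)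

/-- Number of solutions of `x^d + (v-x)^d = 1`. -/
noncomputable def M (d : ℕ) (v : F) : ℕ :=
  (Finset.univ.filter fun x : F => x ^ d + (v - x) ^ d = 1).card

lemma orth {ψ : AddChar F ℂ} (hψ : ψ.IsPrimitive) (b : F) :
    ∑ x : F, ψ (x * b) = if b = 0 then (Fintype.card F : ℂ) else 0 := by
  rw [AddChar.sum_mulShift b hψ]; split_ifs <;> simp

lemma pow_bij {d : ℕ} (hd : 0 < d) (hc : d.Coprime (Fintype.card F - 1)) :
    Function.Bijective (fun x : F => x ^ d) := by
  rw [← Finite.injective_iff_bijective]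
  intro x y h
  have hxy : x ^ d = y ^ d := h
  by_cases hy : y = 0
  · subst hy
    rw [zero_pow hd.ne'] at hxy
    exact pow_eq_zero_iff hd.ne' |>.1 hxy
  · have hx : x ≠ 0 := by
      rintro rfl
      rw [zero_pow hd.ne'] at hxy
      exact hy (pow_eq_zero_iff hd.ne' |>.1 hxy.symm)
    have hcard : (Nat.card Fˣ).Coprime d := by
      rw [Nat.card_eq_fintype_card, Fintype.card_units]; exact hc.symm
    have := (powCoprime hcard).injective (a₁ := Units.mk0 x hx) (a₂ := Units.mk0 y hy)
      (by ext; simpa using hxy)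
    simpa using congrArg Units.val this

lemma neg_pow_d {d : ℕ} (hb : Function.Bijective (fun x : F => x ^ d)) (x : F) :
    (-x) ^ d = - x ^ d := by
  rcases Nat.even_or_odd d with he | ho
  · have h1 : (-1 : F) = 1 := hb.1 (by simp [he.neg_pow])
    have h2 : ∀ z : F, -z = z := fun z => by rw [← neg_one_mul, h1, one_mul]
    rw [h2, h2]
  · exact ho.neg_pow x

lemma sum_units {R : Type*} [AddCommMonoid R] (g : F → R) :
    g 0 + ∑ u : Fˣ, g u = ∑ u : F, g u := by
  rw [← Finset.add_sum_erase Finset.univ g (Finset.mem_univ 0)]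
  congr 1
  refine Finset.sum_bij (fun u _ => (u : F)) ?_ ?_ ?_ ?_
  · intro u _; simp
  · intro u _ v _ h; exact Units.ext h
  · intro b hb; exact ⟨Units.mk0 b (by simpa using hb), by simp, by simp⟩
  · intros; rfl

variable {ψ : AddChar F ℂ} {d : ℕ}

lemma sum_pow_eq (hb : Function.Bijective (fun x : F => x ^ d)) {R : Type*} [AddCommMonoid R]
    (g : F → R) : ∑ x : F, g (x ^ d) = ∑ x : F, g x :=
  Function.Bijective.sum_comp hb g

lemma W_zero (hψ : ψ.IsPrimitive) (hb : Function.Bijective (fun x : F => x ^ d)) :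
    W ψ d 0 = 0 := by
  unfold W
  simp only [zero_mul, add_zero]
  rw [sum_pow_eq hb (fun x => ψ x)]
  simpa using orth hψ 1

lemma zero_pow_d (hb : Function.Bijective (fun x : F => x ^ d)) : (0 : F) ^ d = 0 := by
  rcases Nat.eq_zero_or_pos d with rfl | h
  · have := hb.1 (a₁ := (0 : F)) (a₂ := 1) (by simp)
    simp at this
  · exact zero_pow h.ne'

lemma moment1 (hψ : ψ.IsPrimitive) (hb : Function.Bijective (fun x : F => x ^ d)) :
    ∑ u : F, W ψ d u = Fintype.card F := by
  unfold W
  rw [Finset.sum_comm]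
  have : ∀ x : F, ∑ u : F, ψ (x ^ d + u * x) = if x = 0 then (Fintype.card F : ℂ) else 0 := by
    intro x
    simp only [AddChar.map_add_eq_mul]
    rw [← Finset.mul_sum, orth hψ]
    split_ifs with h
    · subst h; rw [zero_pow_d hb]; simp
    · simp
  simp [this]

lemma corr (hψ : ψ.IsPrimitive) (hb : Function.Bijective (fun x : F => x ^ d)) (v : F)
    (hv : v ≠ 0) :
    ∑ u : F, W ψ d u * W ψ d (v * u) = if v = 1 then (Fintype.card F : ℂ) ^ 2 else 0 := by
  unfold W
  have h1 : ∀ u : F, (∑ x : F, ψ (x ^ d + u * x)) * (∑ y : F, ψ (y ^ d + v * u * y))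
      = ∑ y : F, ∑ x : F, ψ (x ^ d + y ^ d) * ψ (u * (x + v * y)) := by
    intro u
    rw [Finset.sum_mul_sum, Finset.sum_comm]
    refine Finset.sum_congr rfl fun y _ => Finset.sum_congr rfl fun x _ => ?_
    rw [← AddChar.map_add_eq_mul, ← AddChar.map_add_eq_mul]; congr 1; ring
  simp only [h1]
  rw [Finset.sum_comm]
  have h2 : ∀ y : F, ∑ u : F, ∑ x : F, ψ (x ^ d + y ^ d) * ψ (u * (x + v * y))
      = Fintype.card F * ψ (y ^ d * (1 - v ^ d)) := by
    intro y
    rw [Finset.sum_comm]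
    simp only [← Finset.mul_sum, orth hψ]
    rw [Finset.sum_eq_single (-(v * y))]
    · rw [neg_pow_d hb, mul_pow]; simp only [neg_add_cancel, if_true]
      rw [mul_comm]; congr 2; ring
    · intro x _ hx
      rw [if_neg, mul_zero]
      intro h; exact hx (eq_neg_of_add_eq_zero_left h)
    · simp
  simp only [h2]
  rw [← Finset.mul_sum, sum_pow_eq hb (fun y => ψ (y * (1 - v ^ d))), orth hψ]
  have h3 : 1 - v ^ d = 0 ↔ v = 1 := by
    rw [sub_eq_zero]
    constructor
    · intro h; exact (hb.1 (by simpa using h)).symm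
    · rintro rfl; simp
  simp only [h3]
  split_ifs <;> ring

lemma triple (hψ : ψ.IsPrimitive) (hb : Function.Bijective (fun x : F => x ^ d)) (v : F)
    (hv : v ≠ 0) :
    ∑ u : F, W ψ d u ^ 2 * W ψ d (v * u) = (Fintype.card F : ℂ) ^ 2 * M d v := by
  unfold W
  have h1 : ∀ u : F, (∑ x : F, ψ (x ^ d + u * x)) ^ 2 * (∑ y : F, ψ (y ^ d + v * u * y))
      = ∑ z : F, ∑ x : F, ∑ y : F, ψ (x ^ d + y ^ d + z ^ d) * ψ (u * (y + (x + v * z))) := by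
    intro u
    rw [pow_two, Finset.sum_mul_sum, Finset.sum_mul_sum, Finset.sum_comm]
    simp only [Finset.sum_mul]
    refine Finset.sum_congr rfl fun z _ => Finset.sum_congr rfl fun x _ =>
      Finset.sum_congr rfl fun y _ => ?_
    rw [← AddChar.map_add_eq_mul, ← AddChar.map_add_eq_mul, ← AddChar.map_add_eq_mul]
    congr 1; ring
  simp only [h1]
  rw [Finset.sum_comm]
  have h2 : ∀ z : F, ∑ u : F, ∑ x : F, ∑ y : F, ψ (x ^ d + y ^ d + z ^ d) *
      ψ (u * (y + (x + v * z)))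
      = Fintype.card F * ∑ x : F, ψ (x ^ d + (-(x + v * z)) ^ d + z ^ d) := by
    intro z
    rw [Finset.sum_comm, Finset.mul_sum]
    refine Finset.sum_congr rfl fun x _ => ?_
    rw [Finset.sum_comm]
    simp only [← Finset.mul_sum, orth hψ]
    rw [Finset.sum_eq_single (-(x + v * z))]
    · rw [neg_add_cancel, if_pos rfl, mul_comm]
    · intro y _ hy
      rw [if_neg, mul_zero]
      intro h; exact hy (eq_neg_of_add_eq_zero_left h)
    · simp
  simp only [h2]
  rw [← Finset.mul_sum, pow_two, mul_assoc]
  congr 1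
  have h3 : ∀ z : F, ∑ x : F, ψ (x ^ d + (-(x + v * z)) ^ d + z ^ d)
      = (if z = 0 then (Fintype.card F : ℂ) - ∑ x : F, 1 else 0) +
        ∑ x : F, ψ (z ^ d * (1 - (x ^ d + (v - x) ^ d))) := by
    intro z
    by_cases hz : z = 0
    · subst hz
      simp [zero_pow_d hb, neg_pow_d hb]
    · simp only [hz, if_false, zero_add]
      have hbz : Function.Bijective (fun x : F => -z * x) :=
        (Equiv.mulLeft₀ (-z) (neg_ne_zero.2 hz)).bijective
      rw [← Function.Bijective.sum_comp hbz]
      refine Finset.sum_congr rfl fun x _ => ?_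
      congr 1
      have e1 : (-z * x) ^ d = - (z ^ d * x ^ d) := by
        rw [neg_mul, neg_pow_d hb, mul_pow]
      have e2 : (-(-z * x + v * z)) ^ d = - (z ^ d * (v - x) ^ d) := by
        rw [neg_pow_d hb, ← mul_pow]; congr 2; ring
      rw [e1, e2]; ring
  simp only [h3]
  rw [Finset.sum_add_distrib, Finset.sum_comm]
  have h4 : ∀ x : F, ∑ z : F, ψ (z ^ d * (1 - (x ^ d + (v - x) ^ d)))
      = if x ^ d + (v - x) ^ d = 1 then (Fintype.card F : ℂ) else 0 := by
    intro x
    rw [sum_pow_eq hb (fun z => ψ (z * (1 - (x ^ d + (v - x) ^ d)))), orth hψ]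
    have e : (1 - (x ^ d + (v - x) ^ d) = 0) ↔ x ^ d + (v - x) ^ d = 1 := by
      rw [sub_eq_zero]; exact eq_comm
    simp only [e]
  simp only [h4]
  rw [← Finset.sum_filter, ← Finset.sum_filter, Finset.sum_const, Finset.sum_const, M,
    nsmul_eq_mul, nsmul_eq_mul, Finset.sum_const, nsmul_eq_mul, Finset.card_univ, mul_one, sub_self,
    mul_zero, zero_add, mul_comm]

end charsums

end Hel

namespace Hel

lemma dec2 : ∀ t : ZMod 2, t = 0 ∨ t = 1 := by decide
lemma dec3 : ∀ t : ZMod 3, t = 0 ∨ t = 1 ∨ t = 2 := by decide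
lemma dec2n : (-1 : ZMod 2) = 1 := by decide
lemma dec3n : (-1 : ZMod 3) = 2 ∧ (-2 : ZMod 3) = 1 ∧ (2 : ZMod 3) ≠ 1 := by decide

section canonical
open scoped Classical

variable (p : ℕ) [Fact p.Prime] (F : Type*) [Field F] [Fintype F] [Algebra (ZMod p) F]

/-- The canonical additive character. -/
noncomputable def chi : AddChar F ℂ :=
  (ZMod.stdAddChar (N := p)).compAddMonoidHom (Algebra.trace (ZMod p) F).toAddMonoidHom

lemma chi_apply (x : F) : chi p F x = ZMod.stdAddChar (Algebra.trace (ZMod p) F x) := rfl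

lemma chi_prim : (chi p F).IsPrimitive := by
  apply AddChar.IsPrimitive.of_ne_one
  obtain ⟨x, hx⟩ := Algebra.trace_surjective (ZMod p) F 1
  intro h
  have h1 : chi p F x = 1 := by rw [h]; rfl
  rw [chi_apply, hx] at h1
  have h2 := ZMod.isPrimitive_stdAddChar p (a := 1) one_ne_zero
  apply h2
  ext y
  rw [AddChar.mulShift_apply, one_mul, AddChar.one_apply]
  have : y = (y.val : ℕ) • (1 : ZMod p) := by simp
  rw [this, AddChar.map_nsmul_eq_pow, h1, one_pow]

lemma psi_eq (x : F) : psi p F x = chi p F x := by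
  rw [chi_apply, ZMod.stdAddChar_apply, ZMod.toCircle_apply, psi]

lemma weilSum_eq (d : ℕ) (u : F) : weilSum p F d u = W (chi p F) d u := by
  simp only [weilSum, W, psi_eq]

lemma std_pair (hp : p = 2 ∨ p = 3) (t : ZMod p) :
    (ZMod.stdAddChar t : ℂ) + ZMod.stdAddChar (-t) =
      2 - p * ((if t = 1 then 1 else 0) + (if -t = 1 then 1 else 0)) := by
  have h0 : ∑ t : ZMod p, (ZMod.stdAddChar t : ℂ) = 0 := by
    have := orth (F := ZMod p) (ZMod.isPrimitive_stdAddChar p) 1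
    simpa using this
  rcases hp with rfl | rfl
  · have e : ∑ t : ZMod 2, (ZMod.stdAddChar t : ℂ) = ZMod.stdAddChar (0 : ZMod 2)
      + ZMod.stdAddChar (1 : ZMod 2) := Fin.sum_univ_two _
    rw [e] at h0
    rw [AddChar.map_zero_eq_one] at h0
    have h1 : (ZMod.stdAddChar (1 : ZMod 2) : ℂ) = -1 := by linear_combination h0
    have ht : t = 0 ∨ t = 1 := dec2 t
    rcases ht with rfl | rfl
    · simp; norm_num
    · have : (-1 : ZMod 2) = 1 := dec2n
      rw [this, h1]; norm_num
  · have e : ∑ t : ZMod 3, (ZMod.stdAddChar t : ℂ) = ZMod.stdAddChar (0 : ZMod 3)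
      + ZMod.stdAddChar (1 : ZMod 3) + ZMod.stdAddChar (2 : ZMod 3) := Fin.sum_univ_three _
    rw [e] at h0
    rw [AddChar.map_zero_eq_one] at h0
    have ht : t = 0 ∨ t = 1 ∨ t = 2 := dec3 t
    have n1 : (-1 : ZMod 3) = 2 := dec3n.1
    have n2 : (-2 : ZMod 3) = 1 := dec3n.2.1
    have n3 : (2 : ZMod 3) ≠ 1 := dec3n.2.2
    rcases ht with rfl | rfl | rfl
    · simp; norm_num
    · rw [n1, if_pos rfl, if_neg n3]; push_cast; linear_combination h0
    · rw [n2, if_pos rfl, if_neg n3]; push_cast; linear_combination h0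

/-- The integer value of the Weil sum. -/
noncomputable def w (d : ℕ) (u : F) : ℤ :=
  Fintype.card F - p * (Finset.univ.filter fun x : F =>
    Algebra.trace (ZMod p) F (x ^ d + u * x) = 1).card

lemma W_eq_w (hp : p = 2 ∨ p = 3) {d : ℕ} (hb : Function.Bijective (fun x : F => x ^ d)) (u : F) :
    W (chi p F) d u = (w p F d u : ℂ) := by
  set T : F → ZMod p := fun x => Algebra.trace (ZMod p) F (x ^ d + u * x) with hT
  have hneg : ∀ x, T (-x) = - T x := by
    intro x
    simp only [hT]
    rw [← map_neg, neg_pow_d hb]; congr 1; ring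
  have e1 : W (chi p F) d u = ∑ x : F, (ZMod.stdAddChar (T x) : ℂ) := rfl
  have e2 : W (chi p F) d u = ∑ x : F, (ZMod.stdAddChar (-T x) : ℂ) := by
    rw [e1, ← Function.Bijective.sum_comp (Equiv.neg F).bijective]
    simp only [Equiv.neg_apply, hneg]
  have e3 : ∑ x : F, (if -T x = 1 then (1 : ℂ) else 0) = ∑ x : F, (if T x = 1 then (1 : ℂ) else 0) := by
    rw [← Function.Bijective.sum_comp (Equiv.neg F).bijective]
    simp only [Equiv.neg_apply, hneg, neg_neg]
  have e4 : W (chi p F) d u + W (chi p F) d u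
      = ∑ x : F, (2 - (p : ℂ) * ((if T x = 1 then 1 else 0) + (if -T x = 1 then 1 else 0))) := by
    nth_rewrite 1 [e1]; rw [e2, ← Finset.sum_add_distrib]
    exact Finset.sum_congr rfl fun x _ => std_pair p hp (T x)
  rw [Finset.sum_sub_distrib, ← Finset.mul_sum, Finset.sum_add_distrib, e3, Finset.sum_const,
    Finset.card_univ, ← Finset.sum_filter, Finset.sum_const, nsmul_eq_mul, nsmul_eq_mul] at e4
  unfold w
  push_cast
  linear_combination e4 / 2

lemma p_dvd_card : p ∣ Fintype.card F := by
  haveI : CharP F p := charP_of_injective_algebraMap (algebraMap (ZMod p) F).injective p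
  obtain ⟨n, -, hn⟩ := FiniteField.card F p
  rw [hn]; exact dvd_pow_self _ n.pos.ne'

lemma p_dvd_w (d : ℕ) (u : F) : (p : ℤ) ∣ w p F d u := by
  unfold w
  exact dvd_sub (by exact_mod_cast p_dvd_card p F) (dvd_mul_right _ _)

lemma p_dvd_V (hp : p = 2 ∨ p = 3) {d : ℕ} (hb : Function.Bijective (fun x : F => x ^ d)) :
    p ∣ M d (1 : F) := by
  haveI : CharP F p := charP_of_injective_algebraMap (algebraMap (ZMod p) F).injective p
  have hcard := p_dvd_card p F
  have hpp : (p : F) = 0 := CharP.cast_eq_zero F p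
  rcases hp with rfl | rfl
  · have h2 : (2 : F) = 0 := by exact_mod_cast hpp
    let f : Function.End {x : F // x ^ d + (1 - x) ^ d = 1} :=
      fun x => ⟨1 - x.1, by rw [sub_sub_cancel, add_comm]; exact x.2⟩
    have hf : f ^ 2 ^ 1 = 1 := by
      rw [pow_one, pow_two]
      funext x
      apply Subtype.ext
      change 1 - (1 - x.1) = x.1
      ring
    have := Equiv.Perm.card_fixedPoints_modEq hf
    have h0 : Fintype.card ↑(Function.fixedPoints f) = 0 := by
      rw [Fintype.card_eq_zero_iff]
      refine ⟨fun y => ?_⟩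
      have hy : 1 - y.1.1 = y.1.1 := congrArg Subtype.val y.2
      have : (1 : F) = 0 := by linear_combination hy + h2 * y.1.1
      exact one_ne_zero this
    rw [h0, Fintype.card_subtype] at this
    exact (Nat.modEq_zero_iff_dvd).1 this
  · have h3 : (3 : F) = 0 := by exact_mod_cast hpp
    let P : F × F → Prop := fun t => t.1 ^ d + t.2 ^ d = (t.1 + t.2) ^ d
    let f : Function.End {t : F × F // P t} :=
      fun t => ⟨(t.1.2, -(t.1.1 + t.1.2)), by
        have := t.2
        simp only [P] at this ⊢
        rw [neg_pow_d hb, ← this, show t.1.2 + -(t.1.1 + t.1.2) = - t.1.1 by ring, neg_pow_d hb]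
        ring⟩
    have hf : f ^ 3 ^ 1 = 1 := by
      rw [pow_one, pow_succ, pow_two]
      funext t
      apply Subtype.ext
      change ((-(t.1.2 + -(t.1.1 + t.1.2)), -(-(t.1.1 + t.1.2) + -(t.1.2 + -(t.1.1 + t.1.2))))) = t.1
      ext <;> simp
    have hmod := Equiv.Perm.card_fixedPoints_modEq hf
    have h0 : Fintype.card ↑(Function.fixedPoints f) = Fintype.card F := by
      refine Fintype.card_congr ⟨fun y => y.1.1.1, fun x => ⟨⟨(x, x), ?_⟩, ?_⟩, ?_, ?_⟩
      · simp only [P]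
        rw [show x + x = -x by linear_combination x * h3, neg_pow_d hb]
        linear_combination x ^ d * h3
      · change f _ = _
        apply Subtype.ext
        change (x, -(x + x)) = (x, x)
        ext
        · rfl
        · change -(x + x) = x
          linear_combination - x * h3
      · intro y
        have hy : (y.1.1.2, -(y.1.1.1 + y.1.1.2)) = y.1.1 := congrArg Subtype.val y.2
        have h1 : y.1.1.2 = y.1.1.1 := congrArg Prod.fst hy
        apply Subtype.ext; apply Subtype.ext
        change (y.1.1.1, y.1.1.1) = y.1.1
        ext
        · rfl
        · exact h1.symm
      · intro x; rfl
    have hN : Fintype.card {t : F × F // P t}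
        = ∑ s : F, (Finset.univ.filter fun x : F => x ^ d + (s - x) ^ d = s ^ d).card := by
      rw [← Finset.card_sigma, Fintype.card_subtype]
      refine Finset.card_bij' (fun t _ => ⟨t.1 + t.2, t.1⟩) (fun s _ => (s.2, s.1 - s.2)) ?_ ?_ ?_ ?_
      · intro t ht
        simpa [P] using ht
      · intro s hs
        simpa [P] using hs
      · intro t ht; simp
      · intro s hs; simp
    have hs : ∀ s : Fˣ, (Finset.univ.filter fun x : F => x ^ d + ((s : F) - x) ^ d = (s : F) ^ d).card
        = M d (1 : F) := by
      intro s
      symm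
      unfold M
      refine Finset.card_bij' (fun x _ => (s : F) * x) (fun x _ => (s : F)⁻¹ * x) ?_ ?_ ?_ ?_
      · intro x hx
        simp only [Finset.mem_filter, Finset.mem_univ, true_and] at hx ⊢
        rw [show (s : F) - s * x = s * (1 - x) by ring, mul_pow, mul_pow, ← mul_add, hx, mul_one]
      · intro x hx
        simp only [Finset.mem_filter, Finset.mem_univ, true_and] at hx ⊢
        have hs0 : (s : F) ≠ 0 := s.ne_zero
        rw [show 1 - (s : F)⁻¹ * x = (s : F)⁻¹ * (s - x) by field_simp, mul_pow, mul_pow, ← mul_add, hx,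
          ← mul_pow, inv_mul_cancel₀ hs0, one_pow]
      · intro x hx; simp
      · intro x hx; simp
    rw [hN, ← sum_units, Finset.sum_congr rfl fun s _ => hs s, Finset.sum_const, h0] at hmod
    have hz : (Finset.univ.filter fun x : F => x ^ d + ((0 : F) - x) ^ d = (0 : F) ^ d).card
        = Fintype.card F := by
      rw [Finset.filter_true_of_mem, Finset.card_univ]
      intro x _
      rw [zero_sub, neg_pow_d hb, zero_pow_d hb]; ring
    rw [hz, Finset.card_univ, Fintype.card_units, smul_eq_mul] at hmod
    have h5 : 3 ∣ Fintype.card F + (Fintype.card F - 1) * M d (1 : F) :=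
      (Nat.modEq_zero_iff_dvd).1 (hmod.trans ((Nat.modEq_zero_iff_dvd).2 hcard))
    have h6 := (Nat.dvd_add_right hcard).1 h5
    refine (Nat.Coprime.dvd_mul_left ?_).1 h6
    have hpos : 0 < Fintype.card F := Fintype.card_pos
    rw [Nat.Prime.coprime_iff_not_dvd Nat.prime_three]
    omega

end canonical
end Hel

namespace Hel

section abstractgroup
open scoped Classical

/-- The relations satisfied by a Weil spectrum. -/
structure Spec {G : Type*} [CommGroup G] [Fintype G] (q : ℤ) (W : G → ℤ) (M : G → ℕ) : Prop where
  qpos : 0 < q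
  sum1 : ∑ u, W u = q
  corr : ∀ v, ∑ u, W u * W (v * u) = if v = 1 then q ^ 2 else 0
  triple : ∀ v, ∑ u, W u ^ 2 * W (v * u) = q ^ 2 * M v

variable {G : Type*} [CommGroup G] [Fintype G] {q : ℤ} {W : G → ℤ} {M : G → ℕ}

lemma Spec.sum2 (h : Spec q W M) : ∑ u, W u ^ 2 = q ^ 2 := by
  have := h.corr 1
  simp only [one_mul, if_true] at this
  rw [← this]
  exact Finset.sum_congr rfl fun u _ => by ring

lemma Spec.sum3 (h : Spec q W M) : ∑ u, W u ^ 3 = q ^ 2 * M 1 := by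
  rw [← h.triple 1]
  exact Finset.sum_congr rfl fun u _ => by rw [one_mul]; ring

lemma Spec.sum_shift (h : Spec q W M) (u : G) : ∑ v, W (v * u) = q := by
  rw [← h.sum1]
  exact Function.Bijective.sum_comp (Group.mulRight_bijective u) W

lemma Spec.sumM (h : Spec q W M) : ∑ v, (M v : ℤ) = q := by
  have h1 : ∑ v, q ^ 2 * (M v : ℤ) = q ^ 2 * q := by
    simp only [← h.triple]
    rw [Finset.sum_comm]
    simp only [← Finset.mul_sum, h.sum_shift]
    rw [← Finset.sum_mul, h.sum2]
  rw [← Finset.mul_sum] at h1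
  exact mul_left_cancel₀ (pow_ne_zero 2 h.qpos.ne') h1

lemma Spec.sumM2 (h : Spec q W M) : q ^ 2 * ∑ v, (M v : ℤ) ^ 2 = ∑ u, W u ^ 4 := by
  have hcorr : ∀ u t : G, ∑ v, W (v * t) * W (v * u) = if u = t then q ^ 2 else 0 := by
    intro u t
    have := h.corr (u * t⁻¹)
    rw [← Function.Bijective.sum_comp (Group.mulRight_bijective t)] at this
    simp only [mul_inv_eq_one] at this
    rw [← this]
    refine Finset.sum_congr rfl fun v _ => ?_
    congr 2
    rw [mul_comm v t, ← mul_assoc, inv_mul_cancel_right, mul_comm]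
  have hconv : ∀ u : G, ∑ v, (M v : ℤ) * W (v * u) = W u ^ 2 := by
    intro u
    have h1 : q ^ 2 * ∑ v, (M v : ℤ) * W (v * u) = q ^ 2 * W u ^ 2 := by
      rw [Finset.mul_sum]
      simp only [← mul_assoc, ← h.triple, Finset.sum_mul]
      rw [Finset.sum_comm]
      simp only [mul_assoc, ← Finset.mul_sum, hcorr]
      simp [mul_comm]
    exact mul_left_cancel₀ (pow_ne_zero 2 h.qpos.ne') h1
  have h2 : ∀ v, q ^ 2 * (M v : ℤ) ^ 2 = ∑ u, (M v : ℤ) * (W u ^ 2 * W (v * u)) := by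
    intro v
    rw [← Finset.mul_sum, h.triple]; ring
  rw [Finset.mul_sum]
  simp only [h2]
  rw [Finset.sum_comm]
  refine Finset.sum_congr rfl fun u _ => ?_
  have : ∑ v, (M v : ℤ) * (W u ^ 2 * W (v * u)) = W u ^ 2 * ∑ v, (M v : ℤ) * W (v * u) := by
    rw [Finset.mul_sum]; exact Finset.sum_congr rfl fun v _ => by ring
  rw [this, hconv]; ring

lemma Spec.two_le (h : Spec q W M) {ua ub : G} (hne : W ua ≠ W ub) :
    W ua ^ 2 + W ub ^ 2 ≤ q ^ 2 := by
  have hn : ua ≠ ub := fun e => hne (by rw [e])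
  rw [← h.sum2, ← Finset.sum_pair (f := fun u => W u ^ 2) hn]
  exact Finset.sum_le_sum_of_subset_of_nonneg (Finset.subset_univ _) fun i _ _ => sq_nonneg _

/-- Decompose a nonzero integer into a prime power and a prime-to-p part. -/
lemma split_int {p : ℕ} (hp : p.Prime) {a : ℤ} (ha : a ≠ 0) :
    ∃ (k : ℕ) (b : ℤ), a = p ^ k * b ∧ ¬ (p : ℤ) ∣ b := by
  have hfin : FiniteMultiplicity (p : ℤ) a :=
    Int.finiteMultiplicity_iff.2 ⟨by simpa using hp.ne_one, ha⟩
  obtain ⟨b, hb, hb2⟩ := hfin.exists_eq_pow_mul_and_not_dvd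
  exact ⟨_, b, hb, hb2⟩

/-- If all values are nonnegative then every value is `0` or `q`. -/
lemma Spec.nonneg_values (h : Spec q W M) (hn : ∀ u, 0 ≤ W u) (u : G) : W u = 0 ∨ W u = q := by
  have hle : ∀ u, W u ≤ q := by
    intro u
    have : W u ^ 2 ≤ q ^ 2 := by
      rw [← h.sum2]
      exact Finset.single_le_sum (f := fun u => W u ^ 2) (fun i _ => sq_nonneg _) (Finset.mem_univ u)
    exact le_of_sq_le_sq this h.qpos.le
  have hs : ∑ u, W u * (q - W u) = 0 := by
    have : ∀ u, W u * (q - W u) = q * W u - W u ^ 2 := fun u => by ring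
    simp only [this]
    rw [Finset.sum_sub_distrib, ← Finset.mul_sum, h.sum1, h.sum2]; ring
  have := (Finset.sum_eq_zero_iff_of_nonneg
    (fun u _ => mul_nonneg (hn u) (sub_nonneg.2 (hle u)))).1 hs u (Finset.mem_univ u)
  rcases mul_eq_zero.1 this with h1 | h1
  · exact Or.inl h1
  · exact Or.inr (by linarith)

lemma Spec.main_zero (h : Spec q W M) {p m : ℕ} (hp : p.Prime) (hq : q = (p : ℤ) ^ (2 * m))
    (hW : ∀ u, (p : ℤ) ∣ W u) (hV : p ∣ M 1) {a b : ℤ} (ha0 : a ≠ 0) (hb0 : b ≠ 0) (hab : a ≠ b)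
    (hall : ∀ u, W u = 0 ∨ W u = a ∨ W u = b) (hua : ∃ u, W u = a) (hub : ∃ u, W u = b)
    (hval : ¬ (p : ℤ) ^ (m + 1) ∣ a) : False := by
  obtain ⟨ua, hua⟩ := hua
  obtain ⟨ub, hub⟩ := hub
  have hq0 := h.qpos
  have hpa : (p : ℤ) ∣ a := hua ▸ hW ua
  have hpb : (p : ℤ) ∣ b := hub ▸ hW ub
  have h2 := h.two_le (ua := ua) (ub := ub) (by rw [hua, hub]; exact hab)
  rw [hua, hub] at h2
  have hasq : 0 < a ^ 2 := by positivity
  have hbsq : 0 < b ^ 2 := by positivity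
  have haq : a ≠ q := by rintro rfl; linarith
  have hbq : b ≠ q := by rintro rfl; linarith
  -- signs
  have hsign : a * b < 0 := by
    by_contra hcon
    have hpos : 0 < a * b := lt_of_le_of_ne (not_lt.1 hcon) (mul_ne_zero ha0 hb0).symm
    rcases lt_or_gt_of_ne ha0 with hneg | hpa'
    · have hb' : b < 0 := by nlinarith
      have : ∑ u, W u ≤ 0 := Finset.sum_nonpos fun u _ => by
        rcases hall u with e | e | e <;> rw [e] <;> linarith
      rw [h.sum1] at this; linarith
    · have hb' : 0 < b := by nlinarith
      rcases h.nonneg_values (fun u => by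
        rcases hall u with e | e | e <;> rw [e] <;> linarith) ua with e | e
      · exact ha0 (hua ▸ e)
      · exact haq (hua ▸ e)
  -- cubic relation
  have hcub : q * M 1 = (a + b) * q - a * b := by
    have h3 : ∑ u, W u ^ 3 = ∑ u, ((a + b) * W u ^ 2 - a * b * W u) :=
      Finset.sum_congr rfl fun u _ => by
        rcases hall u with e | e | e <;> rw [e] <;> ring
    rw [Finset.sum_sub_distrib, ← Finset.mul_sum, ← Finset.mul_sum, h.sum1, h.sum2, h.sum3] at h3
    apply mul_left_cancel₀ hq0.ne'
    linear_combination h3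
  obtain ⟨k, hk⟩ : ∃ k : ℤ, k = a + b - M 1 := ⟨_, rfl⟩
  have habk : a * b = q * k := by rw [hk]; linear_combination hcub
  have hk0 : k < 0 := by
    by_contra hc
    have : 0 ≤ q * k := mul_nonneg hq0.le (not_lt.1 hc)
    linarith
  have hpk : (p : ℤ) ∣ k := by
    rw [hk]; exact dvd_sub (dvd_add hpa hpb) (by exact_mod_cast hV)
  have hpprime : Prime (p : ℤ) := Nat.prime_iff_prime_int.1 hp
  have hp0 : (p : ℤ) ≠ 0 := hpprime.ne_zero
  have hp1 : (1 : ℤ) ≤ p := by exact_mod_cast hp.one_lt.le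
  obtain ⟨α, a', haa, hpa'⟩ := split_int hp ha0
  have hαm : α ≤ m := by
    by_contra hc
    apply hval
    rw [haa]
    exact Dvd.dvd.mul_right (pow_dvd_pow _ (by omega)) _
  have hpb1 : (p : ℤ) ^ (α + 1) ∣ b := by
    obtain ⟨k', hk'⟩ := hpk
    have e : (p : ℤ) ^ α * (p ^ (2 * m + 1 - α) * k') = p ^ α * (a' * b) := by
      rw [← mul_assoc, ← mul_assoc, ← pow_add, ← haa, habk, hq, hk', show α + (2 * m + 1 - α) = 2 * m + 1 by omega]
      ring
    have e2 := mul_left_cancel₀ (pow_ne_zero α hp0) e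
    have e3 : (p : ℤ) ^ (2 * m + 1 - α) ∣ a' * b := ⟨k', e2.symm⟩
    have e4 := hpprime.pow_dvd_of_dvd_mul_left _ hpa' e3
    exact (pow_dvd_pow _ (by omega)).trans e4
  obtain ⟨b', hb'⟩ := hpb1
  set c' : ℤ := a' - p * b' with hc'
  have hcc : a - b = p ^ α * c' := by rw [haa, hb', hc']; ring
  have hpc' : ¬ (p : ℤ) ∣ c' := by
    intro hd
    apply hpa'
    have : a' = c' + p * b' := by rw [hc']; ring
    rw [this]; exact dvd_add hd (dvd_mul_right _ _)
  have hdiv : ∀ v, v ≠ 1 → a' * c' ∣ M v := by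
    intro v hv
    have e1 : ∑ u, (W u * (W u - b)) * W (v * u) = q ^ 2 * M v := by
      have : ∀ u, (W u * (W u - b)) * W (v * u) = W u ^ 2 * W (v * u) - b * (W u * W (v * u)) :=
        fun u => by ring
      simp only [this]
      rw [Finset.sum_sub_distrib, ← Finset.mul_sum, h.triple, h.corr, if_neg hv]; ring
    have e2 : a' * c' ∣ q ^ 2 * M v := by
      rw [← e1]
      refine Finset.dvd_sum fun u _ => Dvd.dvd.mul_right ?_ _
      rcases hall u with e | e | e
      · rw [e]; simp
      · rw [e, hcc]; nth_rewrite 1 [haa]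
        exact ⟨p ^ α * p ^ α, by ring⟩
      · rw [e]; simp
    have hcop : IsCoprime (a' * c') (q ^ 2) := by
      rw [hq, ← pow_mul]
      apply IsCoprime.pow_right
      refine IsCoprime.symm ((Prime.coprime_iff_not_dvd hpprime).2 ?_)
      intro hd
      rcases hpprime.dvd_or_dvd hd with h1 | h1
      · exact hpa' h1
      · exact hpc' h1
    exact hcop.dvd_of_dvd_mul_left e2
  have hbig : -k < |a' * c'| := by
    have e1 : (p : ℤ) ^ (2 * α) * |a' * c'| = |a * (a - b)| := by
      rw [hcc]; nth_rewrite 1 [haa]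
      rw [show (p : ℤ) ^ α * a' * (p ^ α * c') = p ^ (2 * α) * (a' * c') by ring,
        abs_mul ((p : ℤ) ^ (2 * α)),
        abs_of_nonneg (a := (p : ℤ) ^ (2 * α)) (by positivity)]
    have e2 : |a * (a - b)| = a ^ 2 - a * b := by
      rw [abs_of_nonneg] <;> nlinarith
    have e3 : (p : ℤ) ^ (2 * α) ≤ q := by
      rw [hq]; exact pow_le_pow_right₀ hp1 (by omega)
    have e4 : (p : ℤ) ^ (2 * α) * |a' * c'| ≤ q * |a' * c'| :=
      mul_le_mul_of_nonneg_right e3 (abs_nonneg _)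
    have e5 : q * (-k) < q * |a' * c'| := by nlinarith
    exact lt_of_mul_lt_mul_left e5 hq0.le
  have hMbig : ∀ v, v ≠ 1 → M v = 0 ∨ -k < M v := by
    intro v hv
    rcases Nat.eq_zero_or_pos (M v) with e | e
    · exact Or.inl e
    · right
      have := Int.le_of_dvd (by exact_mod_cast e) ((abs_dvd _ _).2 (hdiv v hv))
      linarith
  have hM2 : ∑ v, (M v : ℤ) ^ 2 = a ^ 2 + a * b + b ^ 2 - k * (a + b) := by
    have e1 := h.sumM2
    have e2 : ∑ u, W u ^ 4 = ∑ u, ((a ^ 2 + a * b + b ^ 2) * W u ^ 2 - a * b * (a + b) * W u) :=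
      Finset.sum_congr rfl fun u _ => by
        rcases hall u with e | e | e <;> rw [e] <;> ring
    rw [Finset.sum_sub_distrib, ← Finset.mul_sum, ← Finset.mul_sum, h.sum1, h.sum2] at e2
    apply mul_left_cancel₀ (pow_ne_zero 2 hq0.ne')
    rw [e1, e2]
    linear_combination (- (a + b) * q) * habk
  have hsum0 : ∑ v ∈ Finset.univ.erase (1 : G), (M v : ℤ) * (M v + k) = 0 := by
    have e1 : ∑ v, (M v : ℤ) * (M v + k) = (a + b) * M 1 := by
      have : ∀ v, (M v : ℤ) * (M v + k) = (M v : ℤ) ^ 2 + k * M v := fun v => by ring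
      simp only [this]
      rw [Finset.sum_add_distrib, ← Finset.mul_sum, h.sumM, hM2]
      have : (M 1 : ℤ) = a + b - k := by rw [hk]; ring
      rw [this]; linear_combination -habk
    rw [← Finset.add_sum_erase _ _ (Finset.mem_univ (1 : G))] at e1
    have : (M 1 : ℤ) + k = a + b := by rw [hk]; ring
    rw [this] at e1
    linarith
  have hMz : ∀ v, v ≠ 1 → M v = 0 := by
    intro v hv
    have := (Finset.sum_eq_zero_iff_of_nonneg (fun v hv' => by
      rcases hMbig v (Finset.ne_of_mem_erase hv') with e | e
      · rw [e]; simp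
      · exact mul_nonneg (by positivity) (by linarith))).1 hsum0 v
      (Finset.mem_erase.2 ⟨hv, Finset.mem_univ v⟩)
    rcases hMbig v hv with e | e
    · exact e
    · rcases mul_eq_zero.1 this with e' | e'
      · exact_mod_cast e'
      · linarith
  have hVq : (M 1 : ℤ) = q := by
    rw [← h.sumM, Finset.sum_eq_single (1 : G)]
    · intro v _ hv; rw [hMz v hv]; simp
    · simp
  rw [hVq] at hcub
  have : (q - a) * (q - b) = 0 := by linear_combination hcub
  rcases mul_eq_zero.1 this with e | e
  · exact haq (by linarith)
  · exact hbq (by linarith)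

end abstractgroup
end Hel

namespace Hel

section nonzerocase
open scoped Classical

lemma arith_contra {p : ℤ} (hp : p = 2 ∨ p = 3) {x q T R Na a : ℤ} (hx : 0 < x) (hx2 : x ^ 2 ≤ q)
    (hxeven : p = 2 → x = 1 ∨ x = 2 ∨ x = 4 ∨ 8 ≤ x)
    (hT : T * x = p * q) (hR : 2 ≤ R) (hN : Na + R = q - 1) (hNa : 1 ≤ Na) (hax : x ≤ |a|)
    (hS : R * T ^ 2 + Na * a ^ 2 ≤ q ^ 2) (hL : T * (Na * |a| - q) ≤ q ^ 2) : False := by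
  have hq : 0 < q := by nlinarith
  have hp0 : 0 < p := by rcases hp with rfl | rfl <;> norm_num
  have hTpos : 0 < T := by
    by_contra hc
    have : T * x ≤ 0 := mul_nonpos_of_nonpos_of_nonneg (not_lt.1 hc) hx.le
    nlinarith [mul_pos hp0 hq]
  have ha2 : x ^ 2 ≤ a ^ 2 := by rw [← sq_abs a]; nlinarith
  -- R p^2 < x^2
  have hRp : R * p ^ 2 < x ^ 2 := by
    have e1 : R * T ^ 2 < q ^ 2 := by nlinarith
    have e2 : R * T ^ 2 * x ^ 2 < q ^ 2 * x ^ 2 := mul_lt_mul_of_pos_right e1 (by positivity)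
    have e3 : R * T ^ 2 * x ^ 2 = q ^ 2 * (R * p ^ 2) := by
      have : R * T ^ 2 * x ^ 2 = R * (T * x) ^ 2 := by ring
      rw [this, hT]; ring
    rw [e3] at e2
    exact lt_of_mul_lt_mul_left e2 (by positivity)
  -- p (Na x - q) ≤ q x
  have hlin : p * (Na * x - q) ≤ q * x := by
    have e0 : T * (Na * x - q) ≤ q ^ 2 := by
      refine le_trans ?_ hL
      exact mul_le_mul_of_nonneg_left (by nlinarith) hTpos.le
    have e1 : T * (Na * x - q) * x ≤ q ^ 2 * x := mul_le_mul_of_nonneg_right e0 hx.le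
    have e2 : T * (Na * x - q) * x = q * (p * (Na * x - q)) := by
      linear_combination (Na * x - q) * hT
    rw [e2] at e1
    have e3 : q * (p * (Na * x - q)) ≤ q * (q * x) := by linarith
    exact le_of_mul_le_mul_left e3 hq
  have hNa' : Na = q - 1 - R := by linarith
  subst hNa'
  rcases hp with rfl | rfl
  · rcases hxeven rfl with rfl | rfl | rfl | h8
    · nlinarith
    · nlinarith
    · have hR3 : R ≤ 3 := by linarith
      have hq16 : q = 16 := by linarith
      subst hq16
      have : T = 8 := by linarith
      subst this
      nlinarith
    · have e1 : 4 * R < q := by linarith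
      have e2 : (2 * (q - 1 - R) - q) * x ≤ 2 * q := by linarith
      have e3 : (q - 4) < 2 * (2 * (q - 1 - R) - q) := by linarith
      nlinarith
  · have h5 : 5 ≤ x := by nlinarith
    have e1 : 9 * R < q := by linarith
    have e2 : (3 * (q - 1 - R) - q) * x ≤ 3 * q := by linarith
    have e3 : (5 * q - 9) < 3 * (3 * (q - 1 - R) - q) := by linarith
    nlinarith

variable {G : Type*} [CommGroup G] [Fintype G] {q : ℤ} {W : G → ℤ} {M : G → ℕ}

lemma sum_three {a b c : ℤ} (hab : a ≠ b) (hac : a ≠ c) (hbc : b ≠ c)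
    (hall : ∀ u, W u = a ∨ W u = b ∨ W u = c) (f : ℤ → ℤ) :
    ∑ u, f (W u) = (Finset.univ.filter fun u => W u = a).card * f a
      + (Finset.univ.filter fun u => W u = b).card * f b
      + (Finset.univ.filter fun u => W u = c).card * f c := by
  have h1 : ∀ u, f (W u) = (if W u = a then f a else 0) + (if W u = b then f b else 0)
      + (if W u = c then f c else 0) := by
    intro u
    rcases hall u with e | e | e <;> rw [e]
    · simp [hab, hac]
    · simp [hab.symm, hbc]
    · simp [hac.symm, hbc.symm]
  simp only [h1]
  rw [Finset.sum_add_distrib, Finset.sum_add_distrib]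
  simp only [← Finset.sum_filter, Finset.sum_const, nsmul_eq_mul]

set_option maxHeartbeats 1600000 in
lemma Spec.main_nonzero (h : Spec q W M) {p m : ℕ} (hp : p = 2 ∨ p = 3)
    (hq : q = (p : ℤ) ^ (2 * m)) (hG : (Fintype.card G : ℤ) = q - 1)
    {a b c : ℤ} (hab : a ≠ b) (hac : a ≠ c) (hbc : b ≠ c)
    (hall : ∀ u, W u = a ∨ W u = b ∨ W u = c)
    (hua : ∃ u, W u = a) (hub : ∃ u, W u = b) (huc : ∃ u, W u = c)
    {α β γ : ℕ} {a' b' c' : ℤ} (haa : a = p ^ α * a') (hbb : b = p ^ β * b') (hcc : c = p ^ γ * c')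
    (hpa : ¬ (p : ℤ) ∣ a') (hpb : ¬ (p : ℤ) ∣ b') (hpc : ¬ (p : ℤ) ∣ c')
    (hαβ : α ≤ β) (hβγ : β ≤ γ) (hαm : α ≤ m) : False := by
  have hpn : p.Prime := by rcases hp with rfl | rfl <;> norm_num
  have hpprime : Prime (p : ℤ) := Nat.prime_iff_prime_int.1 hpn
  have hp0 : (p : ℤ) ≠ 0 := hpprime.ne_zero
  have hp1 : (1 : ℤ) ≤ p := by exact_mod_cast hpn.one_lt.le
  have hq0 := h.qpos
  have ha0 : a' ≠ 0 := by rintro rfl; simp at hpa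
  have hb0 : b' ≠ 0 := by rintro rfl; simp at hpb
  have hc0 : c' ≠ 0 := by rintro rfl; simp at hpc
  have ha : a ≠ 0 := by rw [haa]; exact mul_ne_zero (pow_ne_zero _ hp0) ha0
  have hb : b ≠ 0 := by rw [hbb]; exact mul_ne_zero (pow_ne_zero _ hp0) hb0
  have hc : c ≠ 0 := by rw [hcc]; exact mul_ne_zero (pow_ne_zero _ hp0) hc0
  have hcub : a * b * c * (q - 1) = q * (q * (M 1 - (a + b + c)) + (a * b + b * c + c * a)) := by
    have h3 : ∑ u, W u ^ 3 = ∑ u, ((a + b + c) * W u ^ 2 - (a * b + b * c + c * a) * W u + a * b * c) :=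
      Finset.sum_congr rfl fun u _ => by
        rcases hall u with e | e | e <;> rw [e] <;> ring
    rw [Finset.sum_add_distrib, Finset.sum_sub_distrib, ← Finset.mul_sum, ← Finset.mul_sum, h.sum1,
      h.sum2, h.sum3, Finset.sum_const, nsmul_eq_mul, Finset.card_univ, hG] at h3
    linear_combination -h3
  by_cases hcase : α + β ≤ 2 * m
  · -- then q divides c
    have e1 : (p : ℤ) ^ (α + β) * p ^ (2 * m) ∣ a * b * c * (q - 1) := by
      rw [hcub, mul_comm ((p : ℤ) ^ (α + β)), ← hq]
      apply mul_dvd_mul_left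
      have d1 : (p : ℤ) ^ (α + β) ∣ q := by rw [hq]; exact pow_dvd_pow _ hcase
      have hA : (p : ℤ) ^ α ∣ a := ⟨a', haa⟩
      have hB : (p : ℤ) ^ β ∣ b := ⟨b', hbb⟩
      have hC : (p : ℤ) ^ β ∣ c := (pow_dvd_pow _ hβγ).trans ⟨c', hcc⟩
      have hB' : (p : ℤ) ^ α ∣ b := (pow_dvd_pow _ hαβ).trans hB
      rw [pow_add] at d1 ⊢
      refine dvd_add (Dvd.dvd.mul_right d1 _) (dvd_add (dvd_add (mul_dvd_mul hA hB)
        (mul_dvd_mul hB' hC)) ?_)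
      rw [mul_comm c a]; exact mul_dvd_mul hA hC
    have e2 : a * b * c * (q - 1) = p ^ (α + β) * (a' * (b' * (c * (q - 1)))) := by
      nth_rewrite 1 [haa, hbb]; ring
    rw [e2] at e1
    have e3 := Int.dvd_of_mul_dvd_mul_left (pow_ne_zero _ hp0) e1
    have e4 := hpprime.pow_dvd_of_dvd_mul_left _ hpb (hpprime.pow_dvd_of_dvd_mul_left _ hpa e3)
    have hqc : q ∣ c := by
      by_cases hm : m = 0
      · rw [hq, hm]; simp
      · rw [hq]
        refine hpprime.pow_dvd_of_dvd_mul_right _ ?_ e4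
        intro hd
        have : (p : ℤ) ∣ q := by rw [hq]; exact dvd_pow_self _ (by omega)
        have h1 : (p : ℤ) ∣ 1 := by simpa using dvd_sub this hd
        exact hpprime.not_dvd_one h1
    obtain ⟨ua, hua⟩ := hua
    obtain ⟨uc, huc⟩ := huc
    have h2 := h.two_le (ua := ua) (ub := uc) (by rw [hua, huc]; exact hac)
    rw [hua, huc] at h2
    have h3 : q ≤ |c| := Int.le_of_dvd (abs_pos.2 hc) ((dvd_abs _ _).2 hqc)
    have h4 : 0 < a ^ 2 := by positivity
    rw [← sq_abs c] at h2
    nlinarith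
  · push Not at hcase
    set Na := (Finset.univ.filter fun u => W u = a).card with hNa
    set Nb := (Finset.univ.filter fun u => W u = b).card with hNb
    set Nc := (Finset.univ.filter fun u => W u = c).card with hNc
    have pa : 1 ≤ Na := Finset.card_pos.2 (by obtain ⟨u, hu⟩ := hua; exact ⟨u, by simpa using hu⟩)
    have pb : 1 ≤ Nb := Finset.card_pos.2 (by obtain ⟨u, hu⟩ := hub; exact ⟨u, by simpa using hu⟩)
    have pc : 1 ≤ Nc := Finset.card_pos.2 (by obtain ⟨u, hu⟩ := huc; exact ⟨u, by simpa using hu⟩)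
    have s0 := sum_three hab hac hbc hall (fun _ => 1)
    have s1 := sum_three hab hac hbc hall (fun t => t)
    have s2 := sum_three hab hac hbc hall (fun t => t ^ 2)
    simp only [← hNa, ← hNb, ← hNc] at s0 s1 s2
    rw [Finset.sum_const, nsmul_eq_mul, Finset.card_univ, hG] at s0
    rw [h.sum1] at s1
    rw [h.sum2] at s2
    have pa' : (1 : ℤ) ≤ Na := by exact_mod_cast pa
    have pb' : (1 : ℤ) ≤ Nb := by exact_mod_cast pb
    have pc' : (1 : ℤ) ≤ Nc := by exact_mod_cast pc
    generalize (Na : ℤ) = A at *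
    generalize (Nb : ℤ) = B at *
    generalize (Nc : ℤ) = C at *
    have hT0 : 0 < (p : ℤ) ^ (2 * m + 1 - α) := by positivity
    have hTb : (p : ℤ) ^ (2 * m + 1 - α) ≤ |b| := by
      refine Int.le_of_dvd (abs_pos.2 hb) ((dvd_abs _ _).2 ?_)
      exact (pow_dvd_pow _ (by omega)).trans ⟨b', hbb⟩
    have hTc : (p : ℤ) ^ (2 * m + 1 - α) ≤ |c| := by
      refine Int.le_of_dvd (abs_pos.2 hc) ((dvd_abs _ _).2 ?_)
      exact (pow_dvd_pow _ (by omega)).trans ⟨c', hcc⟩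
    have hTx : (p : ℤ) ^ (2 * m + 1 - α) * p ^ α = p * q := by
      rw [hq, ← pow_add, show 2 * m + 1 - α + α = 2 * m + 1 by omega]; ring
    generalize (p : ℤ) ^ (2 * m + 1 - α) = T at *
    have hax : (p : ℤ) ^ α ≤ |a| :=
      Int.le_of_dvd (abs_pos.2 ha) ((dvd_abs _ _).2 ⟨a', haa⟩)
    have hb2 : T * |b| ≤ b ^ 2 := by
      rw [← sq_abs b, pow_two]; exact mul_le_mul_of_nonneg_right hTb (abs_nonneg _)
    have hc2 : T * |c| ≤ c ^ 2 := by
      rw [← sq_abs c, pow_two]; exact mul_le_mul_of_nonneg_right hTc (abs_nonneg _)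
    have hb3 : T ^ 2 ≤ b ^ 2 := by
      rw [← sq_abs b]; exact pow_le_pow_left₀ hT0.le hTb 2
    have hc3 : T ^ 2 ≤ c ^ 2 := by
      rw [← sq_abs c]; exact pow_le_pow_left₀ hT0.le hTc 2
    refine arith_contra (p := p) (x := (p : ℤ) ^ α) (q := q) (T := T) (R := B + C) (Na := A) (a := a)
      (by rcases hp with rfl | rfl <;> norm_num) (by positivity) ?_ ?_ hTx (by linarith) (by linarith)
      pa' hax ?_ ?_
    · rw [hq, ← pow_mul]; exact pow_le_pow_right₀ hp1 (by omega)
    · intro hp2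
      rw [hp2]
      rcases Nat.lt_or_ge α 3 with h3 | h3
      · interval_cases α <;> norm_num
      · right; right; right
        calc (8 : ℤ) = 2 ^ 3 := by norm_num
          _ ≤ 2 ^ α := pow_le_pow_right₀ (by norm_num) h3
    · nlinarith [mul_le_mul_of_nonneg_left hb3 (by linarith : 0 ≤ B),
        mul_le_mul_of_nonneg_left hc3 (by linarith : 0 ≤ C)]
    · have e1 : A * |a| ≤ q + B * |b| + C * |c| := by
        have : A * |a| = |q - B * b - C * c| := by
          rw [show q - B * b - C * c = A * a by linarith, abs_mul, abs_of_nonneg (by linarith : 0 ≤ A)]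
        rw [this]
        calc |q - B * b - C * c| ≤ |q - B * b| + |C * c| := abs_sub _ _
          _ ≤ |q| + |B * b| + |C * c| := by gcongr; exact abs_sub _ _
          _ = _ := by
            rw [abs_mul, abs_mul, abs_of_nonneg (by linarith : 0 ≤ B),
              abs_of_nonneg (by linarith : 0 ≤ C), abs_of_pos hq0]
      have e2 : T * (A * |a| - q) ≤ T * (B * |b| + C * |c|) :=
        mul_le_mul_of_nonneg_left (by linarith) hT0.le
      have e3 := mul_le_mul_of_nonneg_left hb2 (by linarith : 0 ≤ B)
      have e4 := mul_le_mul_of_nonneg_left hc2 (by linarith : 0 ≤ C)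
      nlinarith [mul_nonneg (by linarith : 0 ≤ A) (sq_nonneg a)]

set_option maxHeartbeats 1600000 in
/-- No three-valued spectrum. -/
lemma Spec.not_three (h : Spec q W M) {p m : ℕ} (hp : p = 2 ∨ p = 3)
    (hq : q = (p : ℤ) ^ (2 * m)) (hG : (Fintype.card G : ℤ) = q - 1)
    (hW : ∀ u, (p : ℤ) ∣ W u) (hV : p ∣ M 1) (hval : ∃ u, ¬ (p : ℤ) ^ (m + 1) ∣ W u) :
    (Set.range W).ncard ≠ 3 := by
  intro h3
  have hpn : p.Prime := by rcases hp with rfl | rfl <;> norm_num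
  obtain ⟨u0, hu0⟩ := hval
  have hu00 : W u0 ≠ 0 := by intro e; rw [e] at hu0; simp at hu0
  obtain ⟨a, b, c, hab, hac, hbc, hset⟩ := Set.ncard_eq_three.1 h3
  have hall : ∀ u, W u = a ∨ W u = b ∨ W u = c := by
    intro u
    have : W u ∈ Set.range W := ⟨u, rfl⟩
    rw [hset] at this
    simpa using this
  have hatt : ∀ t, (t = a ∨ t = b ∨ t = c) → ∃ u, W u = t := by
    intro t ht
    have : t ∈ Set.range W := by rw [hset]; simpa using ht
    exact this
  have hua := hatt a (by simp)
  have hub := hatt b (by simp)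
  have huc := hatt c (by simp)
  clear hatt hset h3
  -- zero case
  have hz : ∀ a b : ℤ, a ≠ 0 → b ≠ 0 → a ≠ b → (∀ u, W u = 0 ∨ W u = a ∨ W u = b) →
      (∃ u, W u = a) → (∃ u, W u = b) → False := by
    intro a b ha hb hab hall hua hub
    rcases hall u0 with e | e | e
    · exact hu00 e
    · exact h.main_zero hpn hq hW hV ha hb hab hall hua hub (e ▸ hu0)
    · exact h.main_zero hpn hq hW hV hb ha hab.symm (fun u => by
        rcases hall u with e | e | e
        · exact Or.inl e
        · exact Or.inr (Or.inr e)
        · exact Or.inr (Or.inl e)) hub hua (e ▸ hu0)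
  by_cases ha0 : a = 0
  · subst ha0
    exact hz b c hab.symm hac.symm hbc hall hub huc
  by_cases hb0 : b = 0
  · subst hb0
    exact hz a c hab hbc.symm hac (fun u => by
      rcases hall u with e | e | e
      · exact Or.inr (Or.inl e)
      · exact Or.inl e
      · exact Or.inr (Or.inr e)) hua huc
  by_cases hc0 : c = 0
  · subst hc0
    exact hz a b hac hbc hab (fun u => by
      rcases hall u with e | e | e
      · exact Or.inr (Or.inl e)
      · exact Or.inr (Or.inr e)
      · exact Or.inl e) hua hub
  obtain ⟨α, a', haa, hpa⟩ := split_int hpn ha0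
  obtain ⟨β, b', hbb, hpb⟩ := split_int hpn hb0
  obtain ⟨γ, c', hcc, hpc⟩ := split_int hpn hc0
  have hmin : α ≤ m ∨ β ≤ m ∨ γ ≤ m := by
    by_contra hcon
    push Not at hcon
    apply hu0
    rcases hall u0 with e | e | e
    · rw [e, haa]; exact Dvd.dvd.mul_right (pow_dvd_pow _ (by omega)) _
    · rw [e, hbb]; exact Dvd.dvd.mul_right (pow_dvd_pow _ (by omega)) _
    · rw [e, hcc]; exact Dvd.dvd.mul_right (pow_dvd_pow _ (by omega)) _
  have p1 : ∀ u, W u = a ∨ W u = c ∨ W u = b := fun u => by rcases hall u with e | e | e <;> simp [e]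
  have p2 : ∀ u, W u = b ∨ W u = a ∨ W u = c := fun u => by rcases hall u with e | e | e <;> simp [e]
  have p3 : ∀ u, W u = b ∨ W u = c ∨ W u = a := fun u => by rcases hall u with e | e | e <;> simp [e]
  have p4 : ∀ u, W u = c ∨ W u = a ∨ W u = b := fun u => by rcases hall u with e | e | e <;> simp [e]
  have p5 : ∀ u, W u = c ∨ W u = b ∨ W u = a := fun u => by rcases hall u with e | e | e <;> simp [e]
  rcases le_total α β with h1 | h1 <;> rcases le_total β γ with h2 | h2 <;>
    rcases le_total α γ with h3 | h3
  · exact h.main_nonzero hp hq hG hab hac hbc hall hua hub huc haa hbb hcc hpa hpb hpc h1 h2 (by omega)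
  · exact h.main_nonzero hp hq hG hab hac hbc hall hua hub huc haa hbb hcc hpa hpb hpc h1 h2 (by omega)
  · exact h.main_nonzero hp hq hG hac hab hbc.symm p1 hua huc hub haa hcc hbb hpa hpc hpb h3 h2 (by omega)
  · exact h.main_nonzero hp hq hG hac.symm hbc.symm hab p4 huc hua hub hcc haa hbb hpc hpa hpb h3 h1 (by omega)
  · exact h.main_nonzero hp hq hG hab.symm hbc hac p2 hub hua huc hbb haa hcc hpb hpa hpc h1 h3 (by omega)
  · exact h.main_nonzero hp hq hG hbc hab.symm hac.symm p3 hub huc hua hbb hcc haa hpb hpc hpa h2 h3 (by omega)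
  · exact h.main_nonzero hp hq hG hbc.symm hac.symm hab.symm p5 huc hub hua hcc hbb haa hpc hpb hpa h2 h1 (by omega)
  · exact h.main_nonzero hp hq hG hbc.symm hac.symm hab.symm p5 huc hub hua hcc hbb haa hpc hpb hpa h2 h1 (by omega)

end nonzerocase
end Hel

namespace Hel

section niho
open scoped Classical

variable (p : ℕ) [Fact p.Prime] (F : Type*) [Field F] [Fintype F] [Algebra (ZMod p) F]

lemma spec (hp : p = 2 ∨ p = 3) {d : ℕ} (hb : Function.Bijective (fun x : F => x ^ d)) :
    Spec (Fintype.card F : ℤ) (fun u : Fˣ => w p F d (u : F)) (fun u : Fˣ => M d (u : F)) := by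
  have hψ := chi_prim p F
  have hW := W_eq_w p F hp hb
  have h0 := W_zero hψ hb
  refine ⟨by exact_mod_cast Fintype.card_pos, ?_, ?_, ?_⟩
  · have := moment1 hψ hb
    rw [← sum_units, h0, zero_add] at this
    simp only [hW] at this
    exact_mod_cast this
  · intro v
    have := corr hψ hb (v : F) v.ne_zero
    rw [← sum_units, h0, zero_mul, zero_add] at this
    simp only [← Units.val_mul, hW, Units.val_eq_one] at this
    have h2 : ((∑ u : Fˣ, w p F d (u : F) * w p F d ((v * u : Fˣ) : F) : ℤ) : ℂ)
        = ((if v = 1 then (Fintype.card F : ℤ) ^ 2 else 0 : ℤ) : ℂ) := by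
      push_cast; rw [← this]; push_cast; rfl
    exact_mod_cast h2
  · intro v
    have := triple hψ hb (v : F) v.ne_zero
    rw [← sum_units, h0, zero_pow two_ne_zero, zero_mul, zero_add] at this
    simp only [← Units.val_mul, hW] at this
    exact_mod_cast this

/-- The power map is additive. -/
def Addv (F : Type*) [Field F] (d : ℕ) : Prop := ∀ x y : F, (x + y) ^ d = x ^ d + y ^ d

variable {F} in
/-- The restriction of the phase to a line is a character. -/
lemma line_sum {K : Type*} [Field K] [Fintype K] [Algebra K F] {d : ℕ}
    (hd : 0 < d) (hadd : Addv K d) (ψ : AddChar F ℂ) (A B : F) :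
    ∃ P : Prop, ∑ k : K, ψ ((algebraMap K F k) ^ d * A + B * algebraMap K F k)
      = if P then (Fintype.card K : ℂ) else 0 := by
  let θ : AddChar K ℂ := ψ.compAddMonoidHom
    { toFun := fun k => (algebraMap K F k) ^ d * A + B * algebraMap K F k
      map_zero' := by simp [hd.ne']
      map_add' := fun x y => by
        rw [← map_pow, hadd x y]; simp only [map_add, map_pow]; ring }
  exact ⟨θ = 0, AddChar.sum_eq_ite θ⟩

lemma addv_values (hp : p = 2 ∨ p = 3) {d : ℕ} (hd : 0 < d)
    (hb : Function.Bijective (fun x : F => x ^ d)) (hadd : Addv F d) (u : F) :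
    w p F d u = 0 ∨ w p F d u = Fintype.card F := by
  obtain ⟨P, hP⟩ := line_sum hd hadd (chi p F) 1 u
  have h1 : W (chi p F) d u = if P then (Fintype.card F : ℂ) else 0 := by
    rw [← hP, W]; simp
  rw [W_eq_w p F hp hb] at h1
  split_ifs at h1
  · right; exact_mod_cast h1
  · left; exact_mod_cast h1

lemma niho_bound (hp : p = 2 ∨ p = 3) {K : Type*} [Field K] [Fintype K] [Algebra K F]
    (hQ : Fintype.card F = Fintype.card K ^ 2) {d : ℕ} (hd : 0 < d)
    (hb : Function.Bijective (fun x : F => x ^ d)) (hadd : Addv K d) (u : F) :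
    - (Fintype.card K : ℤ) ≤ w p F d u := by
  set ψ := chi p F
  set Q := Fintype.card K with hQd
  choose P hP using fun y : F => line_sum hd hadd ψ (y ^ d) (u * y)
  have e1 : ∑ y : F, ∑ k : K, ψ ((algebraMap K F k) ^ d * y ^ d + u * y * algebraMap K F k)
      = (Fintype.card F : ℂ) + (Q - 1 : ℤ) * W ψ d u := by
    rw [Finset.sum_comm, ← sum_units]
    congr 1
    · simp [hd.ne']
    · have : ∀ k : Kˣ, ∑ y : F, ψ ((algebraMap K F k) ^ d * y ^ d + u * y * algebraMap K F k)
          = W ψ d u := by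
        intro k
        have hk : algebraMap K F k ≠ 0 := by simp
        unfold W
        rw [← Function.Bijective.sum_comp (Equiv.mulLeft₀ _ hk).bijective
          (fun x => ψ (x ^ d + u * x))]
        refine Finset.sum_congr rfl fun y _ => ?_
        congr 1
        rw [Equiv.mulLeft₀_apply, mul_pow]; ring
      rw [Finset.sum_congr rfl fun k _ => this k, Finset.sum_const, Finset.card_univ,
        Fintype.card_units, nsmul_eq_mul]
      congr 1
      rw [Nat.cast_sub Fintype.card_pos]; push_cast; rfl
  simp only [hP] at e1
  rw [← Finset.sum_filter, Finset.sum_const, nsmul_eq_mul, W_eq_w p F hp hb, hQ] at e1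
  have e2 : ((Finset.univ.filter fun y => P y).card : ℤ) * Q = Q ^ 2 + (Q - 1) * w p F d u := by
    exact_mod_cast e1
  have hP0 : P 0 := by
    have := hP 0
    by_contra hc
    rw [if_neg hc] at this
    simp [hd.ne'] at this
  have hN : 1 ≤ (Finset.univ.filter fun y => P y).card :=
    Finset.card_pos.2 ⟨0, by simpa using hP0⟩
  have hN' : (1 : ℤ) ≤ (Finset.univ.filter fun y => P y).card := by exact_mod_cast hN
  have hQ1 : (1 : ℤ) < Q := by exact_mod_cast Fintype.one_lt_card
  have e3 : 0 ≤ ((Q : ℤ) - 1) * (w p F d u + Q) := by nlinarith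
  have := nonneg_of_mul_nonneg_right e3 (by linarith)
  linarith

lemma trace_zero_of_max (hp : p = 2 ∨ p = 3) {d : ℕ}
    (hb : Function.Bijective (fun x : F => x ^ d)) {u : F} (hu : w p F d u = Fintype.card F) (x : F) :
    Algebra.trace (ZMod p) F (x ^ d + u * x) = 0 := by
  have hp0 : (p : ℤ) ≠ 0 := by exact_mod_cast (Fact.out : p.Prime).ne_zero
  have h1 : (Finset.univ.filter fun x : F =>
    Algebra.trace (ZMod p) F (x ^ d + u * x) = 1).card = 0 := by
    unfold w at hu
    have : (p : ℤ) * (Finset.univ.filter fun x : F =>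
      Algebra.trace (ZMod p) F (x ^ d + u * x) = 1).card = 0 := by linarith
    rcases mul_eq_zero.1 this with e | e
    · exact absurd e hp0
    · exact_mod_cast e
  rw [Finset.card_eq_zero, Finset.filter_eq_empty_iff] at h1
  have a1 := h1 (Finset.mem_univ x)
  have a2 := h1 (Finset.mem_univ (-x))
  rw [neg_pow_d hb, mul_neg, ← neg_add, map_neg] at a2
  generalize Algebra.trace (ZMod p) F (x ^ d + u * x) = t at *
  rcases hp with rfl | rfl
  · rcases dec2 t with e | e
    · exact e
    · exact absurd e a1
  · rcases dec3 t with e | e | e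
    · exact e
    · exact absurd e a1
    · rw [e] at a2; exact absurd dec3n.2.1 a2

lemma niho (hp : p = 2 ∨ p = 3) {K : Type*} [Field K] [Fintype K] [Algebra K F]
    (hQ : Fintype.card F = Fintype.card K ^ 2) {d : ℕ} (hd : 0 < d)
    (hb : Function.Bijective (fun x : F => x ^ d)) (hadd : Addv K d)
    (hdiv : ∀ u : Fˣ, (p * Fintype.card K : ℤ) ∣ w p F d u) : Addv F d := by
  have hs := spec p F hp hb
  have hp2 : (2 : ℤ) ≤ p := by exact_mod_cast (Fact.out : p.Prime).two_le
  have hQ1 : (1 : ℤ) < Fintype.card K := by exact_mod_cast Fintype.one_lt_card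
  have hnn : ∀ u : Fˣ, 0 ≤ w p F d (u : F) := by
    intro u
    obtain ⟨k, hk⟩ := hdiv u
    have h1 := niho_bound p F hp hQ hd hb hadd (u : F)
    by_contra hc
    have hk0 : k < 0 := by
      by_contra hk0
      apply hc
      rw [hk]
      have : 0 ≤ k := not_lt.1 hk0
      positivity
    have : (p * Fintype.card K : ℤ) * k ≤ (p * Fintype.card K : ℤ) * (-1) :=
      mul_le_mul_of_nonneg_left (by linarith) (by positivity)
    nlinarith
  obtain ⟨u0, hu0⟩ : ∃ u : Fˣ, w p F d (u : F) = Fintype.card F := by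
    by_contra hc
    push Not at hc
    have : ∑ u : Fˣ, w p F d (u : F) = 0 := Finset.sum_eq_zero fun u _ =>
      (hs.nonneg_values hnn u).resolve_right (hc u)
    rw [hs.sum1] at this
    exact hs.qpos.ne' this
  have hT := trace_zero_of_max p F hp hb hu0
  intro x y
  have hB : ∀ s : F, chi p F (s * ((x + y) ^ d - x ^ d - y ^ d)) = 1 := by
    intro s
    obtain ⟨t, rfl⟩ := hb.2 s
    rw [chi_apply]
    have e : t ^ d * ((x + y) ^ d - x ^ d - y ^ d) = ((t * x + t * y) ^ d + u0 * (t * x + t * y))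
        - ((t * x) ^ d + u0 * (t * x)) - ((t * y) ^ d + u0 * (t * y)) := by
      rw [← mul_add, mul_pow, mul_pow, mul_pow]; ring
    change (ZMod.stdAddChar (Algebra.trace (ZMod p) F
      (t ^ d * ((x + y) ^ d - x ^ d - y ^ d))) : ℂ) = 1
    have e' : Algebra.trace (ZMod p) F (t ^ d * ((x + y) ^ d - x ^ d - y ^ d)) = 0 := by
      rw [e, map_sub, map_sub, hT, hT, hT]; simp
    rw [e', AddChar.map_zero_eq_one]
  have h1 := orth (chi_prim p F) ((x + y) ^ d - x ^ d - y ^ d)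
  simp only [hB] at h1
  split_ifs at h1 with h2
  · linear_combination h2
  · simp at h1

end niho
end Hel

namespace Hel

section groupring
open scoped Classical

variable {p : ℕ} [Fact p.Prime] {G : Type*} [CommGroup G] [Fintype G]

lemma ma_base {k : ℕ} (hk : 0 < k) (hG : ∀ g : G, g ^ p ^ k = g) (f : G → ZMod p)
    (h : ∀ v, ∑ u, f u * f (u⁻¹ * v) = 0) (u : G) : f u = 0 := by
  let A : MonoidAlgebra (ZMod p) G := ∑ g, MonoidAlgebra.single g (f g)
  have : CharP (MonoidAlgebra (ZMod p) G) p :=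
    charP_of_injective_algebraMap (algebraMap (ZMod p) (MonoidAlgebra (ZMod p) G)).injective p
  have h1 : A ^ p ^ k = A := by
    simp only [A]
    rw [sum_pow_char_pow]
    refine Finset.sum_congr rfl fun g _ => ?_
    rw [MonoidAlgebra.single_pow, hG, ZMod.pow_card_pow]
  have h2 : A * A = 0 := by
    simp only [A]
    rw [Finset.sum_mul_sum]
    have e : ∀ u : G, ∑ v : G, (MonoidAlgebra.single u (f u) * MonoidAlgebra.single v (f v)
        : MonoidAlgebra (ZMod p) G) = ∑ v : G, MonoidAlgebra.single v (f u * f (u⁻¹ * v)) := by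
      intro u
      rw [← Function.Bijective.sum_comp (Group.mulLeft_bijective u)
        (fun v => MonoidAlgebra.single v (f u * f (u⁻¹ * v)))]
      refine Finset.sum_congr rfl fun v _ => ?_
      rw [MonoidAlgebra.single_mul_single, inv_mul_cancel_left]
    simp only [e]
    rw [Finset.sum_comm]
    refine Finset.sum_eq_zero fun v _ => ?_
    have e2 := map_sum (MonoidAlgebra.singleAddHom (R := ZMod p) v) (fun u => f u * f (u⁻¹ * v))
      Finset.univ
    rw [h v, map_zero] at e2
    exact e2.symm
  have h3 : A = 0 := by
    rw [← h1]
    have h2k : 2 ≤ p ^ k := le_trans (Fact.out : p.Prime).two_le (Nat.le_self_pow hk.ne' p)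
    obtain ⟨r, hr⟩ := Nat.exists_eq_add_of_le h2k
    rw [hr, pow_add, pow_two, h2, zero_mul]
  have h4 : A.coeff u = f u := by
    simp only [A]
    rw [MonoidAlgebra.coeff_sum, Finsupp.finsetSum_apply]
    simp [Finsupp.single_apply]
  rw [← h4, h3]; rfl

lemma ma {k : ℕ} (hk : 0 < k) (hG : ∀ g : G, g ^ p ^ k = g) (s : ℕ) :
    ∀ f : G → ℤ, (∀ v, (p : ℤ) ^ (2 * s + 1) ∣ ∑ u, f u * f (u⁻¹ * v)) →
      ∀ u, (p : ℤ) ^ (s + 1) ∣ f u := by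
  have hp0 : (p : ℤ) ≠ 0 := by exact_mod_cast (Fact.out : p.Prime).ne_zero
  have base : ∀ f : G → ℤ, (∀ v, (p : ℤ) ∣ ∑ u, f u * f (u⁻¹ * v)) → ∀ u, (p : ℤ) ∣ f u := by
    intro f h u
    rw [← ZMod.intCast_zmod_eq_zero_iff_dvd]
    refine ma_base hk hG (fun u => (f u : ZMod p)) (fun v => ?_) u
    have := (ZMod.intCast_zmod_eq_zero_iff_dvd _ p).2 (h v)
    push_cast at this
    exact this
  induction s with
  | zero => intro f h u; simpa using base f (by simpa using h) u
  | succ s ih =>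
    intro f h
    have h1 := base f fun v => (dvd_pow_self _ (by omega)).trans (h v)
    choose g hg using h1
    have h2 : ∀ v, (p : ℤ) ^ (2 * s + 1) ∣ ∑ u, g u * g (u⁻¹ * v) := by
      intro v
      have h3 := h v
      have e : ∑ u, f u * f (u⁻¹ * v) = p ^ 2 * ∑ u, g u * g (u⁻¹ * v) := by
        rw [Finset.mul_sum]
        exact Finset.sum_congr rfl fun u _ => by rw [hg u, hg (u⁻¹ * v)]; ring
      rw [e, show 2 * (s + 1) + 1 = 2 + (2 * s + 1) by ring, pow_add] at h3
      exact Int.dvd_of_mul_dvd_mul_left (pow_ne_zero _ hp0) h3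
    intro u
    rw [hg u, pow_succ']
    exact mul_dvd_mul_left _ (ih g h2 u)

end groupring
end Hel

namespace Hel

section quadratic
open scoped Classical

variable {K F : Type*} [Field K] [Fintype K] [Field F] [Fintype F] [Algebra K F]

lemma finrank_two (hQ : Fintype.card F = Fintype.card K ^ 2) : Module.finrank K F = 2 := by
  have h := Module.card_eq_pow_finrank (K := K) (V := F)
  rw [hQ] at h
  exact (Nat.pow_right_injective (Fintype.one_lt_card (α := K)) h).symm

lemma tr_eq (hQ : Fintype.card F = Fintype.card K ^ 2) (x : F) :
    algebraMap K F (Algebra.trace K F x) = x + x ^ Fintype.card K := by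
  rw [FiniteField.algebraMap_trace_eq_sum_pow, finrank_two hQ, Finset.sum_range_succ,
    Finset.sum_range_one, Nat.card_eq_fintype_card]
  simp

lemma nm_eq (hQ : Fintype.card F = Fintype.card K ^ 2) (x : F) :
    algebraMap K F (Algebra.norm K x) = x * x ^ Fintype.card K := by
  rw [FiniteField.algebraMap_norm_eq_prod_pow, finrank_two hQ, Finset.prod_range_succ,
    Finset.prod_range_one, Nat.card_eq_fintype_card]
  simp

lemma fib_le (hQ : Fintype.card F = Fintype.card K ^ 2) (t : K × K) :
    (Finset.univ.filter fun x : F => (Algebra.trace K F x, Algebra.norm K x) = t).card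
      + (Finset.univ.filter fun a : K × K => (a.1 + a.2, a.1 * a.2) = t).card ≤ 2 := by
  set S := (Finset.univ.filter fun x : F => (Algebra.trace K F x, Algebra.norm K x) = t) with hS
  set R := (Finset.univ.filter fun a : K × K => (a.1 + a.2, a.1 * a.2) = t) with hR
  have inj := (algebraMap K F).injective
  have S1 : ∀ x ∈ S, x + x ^ Fintype.card K = algebraMap K F t.1 ∧
      x * x ^ Fintype.card K = algebraMap K F t.2 := by
    intro x hx
    have hx : (Algebra.trace K F x, Algebra.norm K x) = t := by simpa [hS] using hx
    rw [← tr_eq hQ, ← nm_eq hQ, ← hx]; exact ⟨rfl, rfl⟩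
  have R1 : ∀ a ∈ R, a.1 + a.2 = t.1 ∧ a.1 * a.2 = t.2 := by
    intro a ha
    have ha : (a.1 + a.2, a.1 * a.2) = t := by simpa [hR] using ha
    rw [← ha]; exact ⟨rfl, rfl⟩
  have hSle : ∀ x0 ∈ S, S ⊆ {x0, x0 ^ Fintype.card K} := by
    intro x0 hx0 x hx
    obtain ⟨h1, h2⟩ := S1 x0 hx0
    obtain ⟨h3, h4⟩ := S1 x hx
    have : (x - x0) * (x - x0 ^ Fintype.card K) = 0 := by
      linear_combination h2 - h4 + x * (h3 - h1)
    rw [Finset.mem_insert, Finset.mem_singleton]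
    rcases mul_eq_zero.1 this with e | e
    · exact Or.inl (sub_eq_zero.1 e)
    · exact Or.inr (sub_eq_zero.1 e)
  have hRle : ∀ a0 ∈ R, R ⊆ {a0, (a0.2, a0.1)} := by
    intro a0 ha0 a ha
    obtain ⟨h1, h2⟩ := R1 a0 ha0
    obtain ⟨h3, h4⟩ := R1 a ha
    have : (a.1 - a0.1) * (a.1 - a0.2) = 0 := by
      linear_combination h2 - h4 + a.1 * (h3 - h1)
    rw [Finset.mem_insert, Finset.mem_singleton]
    rcases mul_eq_zero.1 this with e | e
    · left
      have e1 : a.1 = a0.1 := sub_eq_zero.1 e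
      exact Prod.ext e1 (by linear_combination h3 - h1 - e1)
    · right
      have e1 : a.1 = a0.2 := sub_eq_zero.1 e
      exact Prod.ext e1 (by simp only; linear_combination h3 - h1 - e1)
  rcases S.eq_empty_or_nonempty with hSe | ⟨x0, hx0⟩
  · rw [hSe, Finset.card_empty, zero_add]
    rcases R.eq_empty_or_nonempty with hRe | ⟨a0, ha0⟩
    · rw [hRe]; simp
    · exact (Finset.card_le_card (hRle a0 ha0)).trans Finset.card_le_two
  · rcases R.eq_empty_or_nonempty with hRe | ⟨a0, ha0⟩
    · rw [hRe, Finset.card_empty, add_zero]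
      exact (Finset.card_le_card (hSle x0 hx0)).trans Finset.card_le_two
    · obtain ⟨h1, h2⟩ := S1 x0 hx0
      obtain ⟨h3, h4⟩ := R1 a0 ha0
      have key : (x0 - algebraMap K F a0.1) * (x0 - algebraMap K F a0.2) = 0 := by
        have h3' := congrArg (algebraMap K F) h3
        have h4' := congrArg (algebraMap K F) h4
        rw [map_add] at h3'
        rw [map_mul] at h4'
        linear_combination h4' - h2 + x0 * (h1 - h3')
      obtain ⟨c, hc⟩ : ∃ c : K, x0 = algebraMap K F c := by
        rcases mul_eq_zero.1 key with e | e
        · exact ⟨_, sub_eq_zero.1 e⟩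
        · exact ⟨_, sub_eq_zero.1 e⟩
      have hx0f : x0 ^ Fintype.card K = x0 := by
        rw [hc, ← map_pow, FiniteField.pow_card]
      rw [hx0f] at h1 h2
      have hcc1 : c + c = t.1 := inj (by rw [map_add, ← hc, h1])
      have hcc2 : c * c = t.2 := inj (by rw [map_mul, ← hc, h2])
      have hSs : S.card ≤ 1 := by
        have := hSle x0 hx0
        rw [hx0f, Finset.pair_eq_singleton] at this
        simpa using Finset.card_le_card this
      have hRs : R.card ≤ 1 := by
        have hmem : (c, c) ∈ R := by
          simp only [hR, Finset.mem_filter, Finset.mem_univ, true_and]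
          exact Prod.ext hcc1 hcc2
        have := hRle _ hmem
        rw [Finset.pair_eq_singleton] at this
        simpa using Finset.card_le_card this
      omega

lemma fib_eq (hQ : Fintype.card F = Fintype.card K ^ 2) (t : K × K) :
    (Finset.univ.filter fun x : F => (Algebra.trace K F x, Algebra.norm K x) = t).card
      + (Finset.univ.filter fun a : K × K => (a.1 + a.2, a.1 * a.2) = t).card = 2 := by
  have h := (Finset.sum_eq_sum_iff_of_le (s := (Finset.univ : Finset (K × K)))
    (fun t _ => fib_le hQ t)).1 ?_ t (Finset.mem_univ t)
  · exact h
  · rw [Finset.sum_add_distrib,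
      ← Finset.card_eq_sum_card_fiberwise (fun x _ => Finset.mem_coe.2 (Finset.mem_univ _)),
      ← Finset.card_eq_sum_card_fiberwise (fun x _ => Finset.mem_coe.2 (Finset.mem_univ _))]
    simp only [Finset.card_univ, Finset.sum_const, Fintype.card_prod, smul_eq_mul, hQ]
    ring

lemma sum_tr_nm (hQ : Fintype.card F = Fintype.card K ^ 2) (g : K × K → ℂ) :
    ∑ x : F, g (Algebra.trace K F x, Algebra.norm K x) + ∑ a : K × K, g (a.1 + a.2, a.1 * a.2)
      = 2 * ∑ t : K × K, g t := by
  have e : ∀ {ι : Type _} [Fintype ι] (φ : ι → K × K), ∑ x, g (φ x)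
      = ∑ t : K × K, (Finset.univ.filter fun x => φ x = t).card * g t := by
    intro ι _ φ
    rw [← Finset.sum_fiberwise Finset.univ φ (fun x => g (φ x))]
    refine Finset.sum_congr rfl fun t _ => ?_
    rw [← nsmul_eq_mul, ← Finset.sum_const]
    refine Finset.sum_congr rfl fun x hx => ?_
    rw [(Finset.mem_filter.1 hx).2]
  have e' : ∑ a : K × K, g (a.1 + a.2, a.1 * a.2) = ∑ t : K × K,
      (Finset.univ.filter fun a : K × K => (a.1 + a.2, a.1 * a.2) = t).card * g t := by
    rw [← Finset.sum_fiberwise Finset.univ (fun a : K × K => (a.1 + a.2, a.1 * a.2))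
      (fun a => g (a.1 + a.2, a.1 * a.2))]
    refine Finset.sum_congr rfl fun t _ => ?_
    rw [← nsmul_eq_mul, ← Finset.sum_const]
    refine Finset.sum_congr rfl fun x hx => ?_
    rw [(Finset.mem_filter.1 hx).2]
  rw [e (fun x : F => (Algebra.trace K F x, Algebra.norm K x)), e', ← Finset.sum_add_distrib,
    Finset.mul_sum]
  refine Finset.sum_congr rfl fun t _ => ?_
  have := fib_eq hQ t
  rw [← add_mul]; congr 1
  exact_mod_cast this

end quadratic
end Hel

namespace Hel

section pushforward
open scoped Classical

variable (p : ℕ) [Fact p.Prime] {K F : Type*} [Field K] [Fintype K] [Field F] [Fintype F]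
  [Algebra (ZMod p) K] [Algebra (ZMod p) F] [Algebra K F] [IsScalarTower (ZMod p) K F]

lemma chi_tower (x : F) : chi p F x = chi p K (Algebra.trace K F x) := by
  rw [chi_apply, chi_apply, Algebra.trace_trace]

lemma chi_sum : ∑ x : K, chi p K x = 0 := by
  simpa using orth (chi_prim p K) 1

lemma hd_sum (hQ : Fintype.card F = Fintype.card K ^ 2) {d : ℕ}
    (hbF : Function.Bijective (fun x : F => x ^ d)) (hbK : Function.Bijective (fun x : K => x ^ d))
    (h : K → ℂ) :
    ∑ x : F, chi p F (x ^ d) * h (Algebra.norm K x)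
      = - ∑ a : K, ∑ b : K, chi p K (a ^ d + b ^ d) * h (a * b) := by
  let e : K ≃ K := Equiv.ofBijective _ hbK
  have he : ∀ x : K, e.symm (x ^ d) = x := fun x => e.symm_apply_apply x
  have h1 := sum_tr_nm (F := F) hQ (fun t => chi p K t.1 * h (e.symm t.2))
  have h2 : ∑ t : K × K, chi p K t.1 * h (e.symm t.2) = 0 := by
    rw [Fintype.sum_prod_type]
    simp only [← Finset.mul_sum]
    rw [← Finset.sum_mul, chi_sum, zero_mul]
  rw [h2, mul_zero, ← sum_pow_eq hbF
    (fun x => chi p K (Algebra.trace K F x) * h (e.symm (Algebra.norm K x))),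
    Fintype.sum_prod_type] at h1
  simp only [map_pow (Algebra.norm K), he, ← chi_tower] at h1
  rw [eq_neg_iff_add_eq_zero, ← h1]
  congr 1
  rw [← sum_pow_eq hbK (fun a => ∑ b : K, chi p K (a + b) * h (e.symm (a * b)))]
  refine Finset.sum_congr rfl fun a _ => ?_
  rw [← sum_pow_eq hbK (fun b => chi p K (a ^ d + b) * h (e.symm (a ^ d * b)))]
  refine Finset.sum_congr rfl fun b _ => ?_
  rw [← mul_pow, he]

/-- Kloosterman sum. -/
noncomputable def Kl (p : ℕ) [Fact p.Prime] (K : Type*) [Field K] [Fintype K]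
    [Algebra (ZMod p) K] (s : K) : ℂ := ∑ c : Kˣ, chi p K (c + (c : K)⁻¹ * s)

lemma Kl_zero : Kl p K 0 = -1 := by
  unfold Kl
  simp only [mul_zero, add_zero]
  have := chi_sum p (K := K)
  rw [← sum_units, AddChar.map_zero_eq_one] at this
  linear_combination this

lemma Kl_pairs (s : K) :
    ∑ a : K, ∑ b : K, chi p K (a + b) * (if a * b = s then 1 else 0) = Kl p K s := by
  rw [← sum_units]
  have h0 : ∑ b : K, chi p K (0 + b) * (if 0 * b = s then (1 : ℂ) else 0) = 0 := by
    simp only [zero_mul, zero_add]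
    rw [← Finset.sum_mul, chi_sum, zero_mul]
  rw [h0, zero_add, Kl]
  refine Finset.sum_congr rfl fun a _ => ?_
  rw [Finset.sum_eq_single ((a : K)⁻¹ * s)]
  · rw [if_pos (by rw [mul_inv_cancel_left₀ a.ne_zero]), mul_one]
  · intro b _ hb
    rw [if_neg, mul_zero]
    rintro rfl
    exact hb (by rw [inv_mul_cancel_left₀ a.ne_zero])
  · simp

lemma E_eq (hQ : Fintype.card F = Fintype.card K ^ 2) (s : K) :
    ∑ x : F, chi p F x * (if Algebra.norm K x = s then 1 else 0) = - Kl p K s := by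
  have := hd_sum p (F := F) (d := 1) hQ (by simpa using Function.bijective_id)
    (by simpa using Function.bijective_id) (fun t : K => if t = s then 1 else 0)
  simp only [pow_one] at this
  rw [this, Kl_pairs]

lemma norm_card (hQ : Fintype.card F = Fintype.card K ^ 2) (v : Kˣ) :
    ∑ x : F, (if Algebra.norm K x = (v : K) then (1 : ℂ) else 0) = Fintype.card K + 1 := by
  have h1 := sum_tr_nm (F := F) hQ (fun t => if t.2 = (v : K) then 1 else 0)
  rw [Fintype.sum_prod_type, Fintype.sum_prod_type] at h1
  have h2 : ∀ a : Kˣ, ∑ b : K, (if (a : K) * b = (v : K) then (1 : ℂ) else 0) = 1 := by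
    intro a
    rw [Finset.sum_eq_single ((a : K)⁻¹ * v)]
    · rw [if_pos (by rw [mul_inv_cancel_left₀ a.ne_zero])]
    · intro b _ hb
      rw [if_neg]
      intro hc
      rw [← hc] at hb
      exact hb (by rw [inv_mul_cancel_left₀ a.ne_zero])
    · simp
  have hv : ∀ b : K, (if 0 * b = (v : K) then (1 : ℂ) else 0) = 0 := by
    intro b; rw [zero_mul, if_neg v.ne_zero.symm]
  have h3 : ∑ a : K, ∑ b : K, (if a * b = (v : K) then (1 : ℂ) else 0) = Fintype.card K - 1 := by
    rw [← sum_units (fun a : K => ∑ b : K, (if a * b = (v : K) then (1 : ℂ) else 0))]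
    simp only [h2, hv]
    simp only [Finset.sum_const_zero, zero_add, Finset.sum_const, Finset.card_univ,
      Fintype.card_units, nsmul_eq_mul, mul_one]
    rw [Nat.cast_sub Fintype.card_pos]
    push_cast
    ring
  simp only [h3] at h1
  simp only [Finset.sum_const, Finset.card_univ,
    Fintype.card_units, nsmul_eq_mul, Finset.sum_ite_eq', Finset.mem_univ, if_true, mul_one] at h1
  linear_combination h1

lemma S_eq (v : Kˣ) (a b : K) :
    ∑ c : Kˣ, chi p K (c * a + ((c⁻¹ * v : Kˣ) : K) * b)
      = Kl p K (v * (a * b)) + (if a = 0 ∧ b = 0 then (Fintype.card K : ℂ) else 0) := by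
  by_cases ha : a = 0
  · subst ha
    simp only [mul_zero, zero_mul, zero_add, Kl_zero, true_and]
    by_cases hb : b = 0
    · subst hb
      simp only [mul_zero, AddChar.map_zero_eq_one, if_true, Finset.sum_const, Finset.card_univ,
        Fintype.card_units, nsmul_eq_mul]
      rw [Nat.cast_sub Fintype.card_pos]
      push_cast; ring
    · rw [if_neg hb, add_zero, ← Kl_zero p (K := K), Kl]
      simp only [mul_zero, add_zero]
      let e : Kˣ ≃ Kˣ := (Equiv.inv Kˣ).trans (Equiv.mulRight (v * Units.mk0 b hb))
      rw [← Equiv.sum_comp e (fun c : Kˣ => chi p K (c : K))]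
      refine Finset.sum_congr rfl fun c _ => ?_
      congr 1
      simp [e, mul_assoc]
  · rw [if_neg (fun h => ha h.1), add_zero, Kl]
    rw [← Equiv.sum_comp (Equiv.mulRight (Units.mk0 a ha))
      (fun c : Kˣ => chi p K (c + (c : K)⁻¹ * (v * (a * b))))]
    refine Finset.sum_congr rfl fun c _ => ?_
    congr 1
    simp
    field_simp

lemma pushforward (hQ : Fintype.card F = Fintype.card K ^ 2) {d : ℕ}
    (hbF : Function.Bijective (fun x : F => x ^ d)) (hbK : Function.Bijective (fun x : K => x ^ d))
    (v : Kˣ) :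
    ∑ u : F, W (chi p F) d u * (if Algebra.norm K u = (v : K) then 1 else 0)
      = ∑ c : Kˣ, W (chi p K) d c * W (chi p K) d ((c⁻¹ * v : Kˣ) : K) := by
  have hI : ∀ x : F, ∑ u : F, chi p F (u * x) * (if Algebra.norm K u = (v : K) then 1 else 0)
      = - Kl p K (v * Algebra.norm K x) + (if x = 0 then (Fintype.card K : ℂ) else 0) := by
    intro x
    by_cases hx : x = 0
    · subst hx
      have hn0 : Algebra.norm K (0 : F) = 0 := Algebra.norm_zero
      simp only [mul_zero, AddChar.map_zero_eq_one, one_mul, norm_card hQ, hn0, Kl_zero, if_true]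
      ring
    · rw [if_neg hx, add_zero, ← E_eq p (F := F) hQ, ← Equiv.sum_comp (Equiv.mulRight₀ x hx)
        (fun y => chi p F y * (if Algebra.norm K y = v * Algebra.norm K x then 1 else 0))]
      refine Finset.sum_congr rfl fun u _ => ?_
      rw [Equiv.mulRight₀_apply, map_mul (Algebra.norm K)]
      have hnx : Algebra.norm K x ≠ 0 := by rwa [Ne, Algebra.norm_eq_zero_iff]
      simp only [mul_left_inj' hnx]
  have hL : ∑ u : F, W (chi p F) d u * (if Algebra.norm K u = (v : K) then 1 else 0)
      = ∑ x : F, chi p F (x ^ d) *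
        ∑ u : F, chi p F (u * x) * (if Algebra.norm K u = (v : K) then 1 else 0) := by
    simp only [W, Finset.sum_mul, Finset.mul_sum]
    rw [Finset.sum_comm]
    refine Finset.sum_congr rfl fun x _ => Finset.sum_congr rfl fun u _ => ?_
    rw [AddChar.map_add_eq_mul, mul_assoc]
  have hR : ∑ c : Kˣ, W (chi p K) d c * W (chi p K) d ((c⁻¹ * v : Kˣ) : K)
      = ∑ a : K, ∑ b : K, chi p K (a ^ d + b ^ d) *
        ∑ c : Kˣ, chi p K (c * a + ((c⁻¹ * v : Kˣ) : K) * b) := by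
    simp only [W, Finset.sum_mul_sum]
    simp only [Finset.mul_sum]
    rw [Finset.sum_comm]
    refine Finset.sum_congr rfl fun a _ => ?_
    rw [Finset.sum_comm]
    refine Finset.sum_congr rfl fun b _ => Finset.sum_congr rfl fun c _ => ?_
    rw [← AddChar.map_add_eq_mul, ← AddChar.map_add_eq_mul]
    congr 1; ring
  rw [hL, hR]
  simp only [hI, S_eq, mul_add, Finset.sum_add_distrib]
  congr 1
  · have := hd_sum p (F := F) hQ hbF hbK (fun s => - Kl p K (v * s))
    rw [this]
    simp only [mul_neg, Finset.sum_neg_distrib, neg_neg]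
  · have z1 := zero_pow_d hbF
    have z2 := zero_pow_d hbK
    rw [Finset.sum_eq_single (0 : F), Finset.sum_eq_single (0 : K), Finset.sum_eq_single (0 : K)]
    · simp [z1, z2]
    · intro b _ hb; simp [hb]
    · simp
    · intro a _ ha; simp [ha]
    · simp
    · intro x _ hx; simp [hx]
    · simp

lemma push_div (hp : p = 2 ∨ p = 3) (hQ : Fintype.card F = Fintype.card K ^ 2) {d : ℕ}
    (hbF : Function.Bijective (fun x : F => x ^ d)) (hbK : Function.Bijective (fun x : K => x ^ d))
    {s : ℕ} (hs : 0 < s) (hK : Fintype.card K = p ^ (2 * s))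
    (hdiv : ∀ u : Fˣ, (p : ℤ) ^ (2 * s + 1) ∣ w p F d u) (c : Kˣ) :
    (p : ℤ) ^ (s + 1) ∣ w p K d c := by
  refine ma (p := p) (G := Kˣ) (k := 2 * s) (by omega) ?_ s (fun c => w p K d (c : K)) ?_ c
  · intro g
    ext
    rw [Units.val_pow_eq_pow_val, ← hK, FiniteField.pow_card]
  · intro v
    have h := pushforward p hQ hbF hbK v
    simp only [W_eq_w p F hp hbF, W_eq_w p K hp hbK] at h
    have h' : ∑ u : F, w p F d u * (if Algebra.norm K u = (v : K) then 1 else 0)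
      = ∑ c : Kˣ, w p K d c * w p K d ((c⁻¹ * v : Kˣ) : K) := by
      have e : ((∑ u : F, w p F d u * (if Algebra.norm K u = (v : K) then 1 else 0) : ℤ) : ℂ)
        = ((∑ c : Kˣ, w p K d c * w p K d ((c⁻¹ * v : Kˣ) : K) : ℤ) : ℂ) := by
        push_cast
        exact_mod_cast h
      exact_mod_cast e
    rw [← h']
    refine Finset.dvd_sum fun u _ => Dvd.dvd.mul_right ?_ _
    by_cases hu : u = 0
    · subst hu
      have h0 := W_zero (chi_prim p F) hbF
      rw [W_eq_w p F hp hbF] at h0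
      have : w p F d 0 = 0 := by exact_mod_cast h0
      rw [this]; exact dvd_zero _
    · exact hdiv (Units.mk0 u hu)

end pushforward
end Hel

namespace Hel

section upper
open scoped Classical

lemma addv_base (p : ℕ) [Fact p.Prime] (hp : p = 2 ∨ p = 3) (F : Type*) [Field F] [Fintype F]
    (hcard : Fintype.card F = p) {d : ℕ} (hd : 0 < d) (hcop : d.Coprime (Fintype.card F - 1)) :
    Addv F d := by
  have key : ∀ x : F, x ^ d = x := by
    intro x
    have hx := FiniteField.pow_card x
    rw [hcard] at hx hcop
    rcases hp with rfl | rfl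
    · have h : x * (x - 1) = 0 := by linear_combination hx
      rcases mul_eq_zero.mp h with h | h
      · rw [h, zero_pow hd.ne']
      · rw [sub_eq_zero.mp h, one_pow]
    · have h : x * ((x - 1) * (x + 1)) = 0 := by linear_combination hx
      have hodd : Odd d := by
        rwa [← Nat.coprime_two_right]
      rcases mul_eq_zero.mp h with h | h
      · rw [h, zero_pow hd.ne']
      · rcases mul_eq_zero.mp h with h | h
        · rw [sub_eq_zero.mp h, one_pow]
        · rw [eq_neg_of_add_eq_zero_left h, hodd.neg_one_pow]
  intro x y
  rw [key, key, key]

universe u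

lemma exists_sub (p : ℕ) [Fact p.Prime] (F : Type u) [Field F] [Fintype F] [Algebra (ZMod p) F]
    (j : ℕ) (hcard : Fintype.card F = p ^ (2 ^ (j + 1))) :
    ∃ K : IntermediateField (ZMod p) F, Fintype.card K = p ^ (2 ^ j) := by
  have h2 : (2 ^ j : ℕ) ≠ 0 := by positivity
  have hF : Module.finrank (ZMod p) F = 2 ^ (j + 1) := by
    have := FiniteField.pow_finrank_eq_card p F
    rw [hcard] at this
    exact Nat.pow_right_injective (Fact.out : p.Prime).two_le this
  have hG := GaloisField.finrank p h2
  obtain ⟨f⟩ := FiniteField.nonempty_algHom_of_finrank_dvd (F := ZMod p)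
    (K := GaloisField p (2 ^ j)) (L := F) (by rw [hG, hF, pow_succ]; exact dvd_mul_right _ _)
  refine ⟨f.fieldRange, ?_⟩
  rw [← Nat.card_eq_fintype_card, ← GaloisField.card p (2 ^ j) h2]
  exact (Nat.card_congr (Equiv.ofInjective f f.injective)).symm

lemma upper (p : ℕ) [Fact p.Prime] (hp : p = 2 ∨ p = 3) {d : ℕ} (hd : 0 < d) (j : ℕ) :
    ∀ (F : Type u) [Field F] [Fintype F] [Algebra (ZMod p) F],
      Fintype.card F = p ^ (2 ^ j) → d.Coprime (Fintype.card F - 1) →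
      Addv F d ∨ ∃ m, 2 ^ j = 2 * m ∧ ∃ u : Fˣ, ¬ (p : ℤ) ^ (m + 1) ∣ w p F d u := by
  induction j with
  | zero =>
    intro F _ _ _ hcard hcop
    exact Or.inl (addv_base p hp F (by simpa using hcard) hd hcop)
  | succ j ih =>
    intro F _ _ _ hcard hcop
    obtain ⟨K, hK⟩ := exists_sub p F j hcard
    have hQ : Fintype.card F = Fintype.card K ^ 2 := by
      rw [hcard, hK, pow_succ, pow_mul]
    have hcopK : d.Coprime (Fintype.card K - 1) := by
      refine Nat.Coprime.coprime_dvd_right ?_ hcop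
      rw [hQ]
      simpa using Nat.sub_dvd_pow_sub_pow (Fintype.card K) 1 2
    have hbF := pow_bij (F := F) hd hcop
    have hbK := pow_bij (F := K) hd hcopK
    by_contra hcon
    push Not at hcon
    obtain ⟨hna, hdiv⟩ := hcon
    have hdiv := hdiv (2 ^ j) (by rw [pow_succ]; ring)
    rcases ih K hK hcopK with h | ⟨s, hs, c, hc⟩
    · refine hna (niho p F hp (K := K) hQ hd hbF h fun u => ?_)
      rw [hK]
      convert hdiv u using 1
      push_cast; ring
    · apply hc
      rw [hs] at hK hdiv
      exact push_div p hp hQ hbF hbK (by have := pow_pos (n := j) (a := 2) (by norm_num : 0 < 2); omega) hK hdiv c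

end upper

end Hel

open scoped Classical in
theorem stmt_19 (p : ℕ) [Fact p.Prime] (hp : p = 2 ∨ p = 3)
    (F : Type*) [Field F] [Fintype F] [Algebra (ZMod p) F]
    (j : ℕ) (hcard : Fintype.card F = p ^ (2 ^ j))
    (d : ℕ) (hd : 0 < d) (hcop : Nat.Coprime d (Fintype.card F - 1)) :
    (Set.range fun u : Fˣ => weilSum p F d u).ncard ≠ 3 := by
  have hb := Hel.pow_bij (F := F) hd hcop
  have hr : (Set.range fun u : Fˣ => weilSum p F d u)
      = Set.image (fun z : ℤ => (z : ℂ)) (Set.range fun u : Fˣ => Hel.w p F d (u : F)) := by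
    rw [← Set.range_comp]
    congr 1
    funext u
    simp only [Function.comp]
    rw [Hel.weilSum_eq, Hel.W_eq_w p F hp hb]
  rw [hr, Set.ncard_image_of_injective _ Int.cast_injective]
  rcases Hel.upper p hp hd j F hcard hcop with h | ⟨m, hm, hu⟩
  · intro h3
    have hsub : (Set.range fun u : Fˣ => Hel.w p F d (u : F))
        ⊆ ({0, (Fintype.card F : ℤ)} : Set ℤ) := by
      rintro _ ⟨u, rfl⟩
      exact Hel.addv_values p F hp hd hb h u
    have h1 := Set.ncard_le_ncard hsub (Set.toFinite _)
    have h2 := Set.ncard_insert_le (0 : ℤ) {(Fintype.card F : ℤ)}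
    rw [Set.ncard_singleton] at h2
    omega
  · refine (Hel.spec p F hp hb).not_three (p := p) (m := m) hp ?_ ?_ ?_ ?_ hu
    · rw [hcard, hm]; push_cast; rfl
    · rw [Fintype.card_units, Nat.cast_sub Fintype.card_pos]; rfl
    · intro u; exact Hel.p_dvd_w p F d u
    · exact Hel.p_dvd_V p F hp hb
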